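/- arXiv:1902.04055 — 3 statements merged into one kernel-verified Lean document; each statement's English description precedes it below -/
import Mathlib

section
/- For n ≥ 4, the number of permutations in S_n at pancake distance exactly 4 from the identity equals (2n⁴ − 15n³ + 29n² + 6n − 34)/2. -/
/-- The prefix reversal `r_i`, as a function on `{1,2,...}` (one-line positions):
it sends `j` to `i+1-j` for `1 ≤ j ≤ i` and fixes everything else. -/
def pancakeFun (i : ℕ) : ℕ → ℕ := fun j => if 1 ≤ j ∧ j ≤ i then i + 1 - j else j

lemma pancakeFun_invol (i : ℕ) : Function.Involutive (pancakeFun i) := by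
  intro j; unfold pancakeFun; split_ifs <;> omega

/-- The pancake flip (prefix reversal) `r_i`, as a permutation. -/
def pancakeFlip (i : ℕ) : Equiv.Perm ℕ := Function.Involutive.toPerm _ (pancakeFun_invol i)


/-- `π` is a product of `k` pancake flips `r_i` with `2 ≤ i ≤ n`. -/
def pancakeWord (n k : ℕ) (π : Equiv.Perm ℕ) : Prop :=
  ∃ l : List ℕ, l.length = k ∧ (∀ i ∈ l, 2 ≤ i ∧ i ≤ n) ∧ (l.map pancakeFlip).prod = π

/-- The pancake distance from the identity to `π` (in `S_n`) is exactly `k`. -/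
def pancakeDistEq (n k : ℕ) (π : Equiv.Perm ℕ) : Prop :=
  pancakeWord n k π ∧ ∀ m < k, ¬ pancakeWord n m π

namespace Pancake

/-- product of a word of flips -/
def W (l : List ℕ) : Equiv.Perm ℕ := (l.map pancakeFlip).prod

/-- graph of one flip, on positive positions -/
def Step (i : ℕ) (j k : ℤ) : Prop := (j ≤ i ∧ k = i + 1 - j) ∨ (i < j ∧ k = j)

/-- graph of a sequence of flips, applied from left to right -/
def Chain : List ℕ → ℤ → ℤ → Prop
  | [], t, w => t = w
  | a :: l, t, w => ∃ u, Step a t u ∧ Chain l u w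

lemma flip_apply (i j : ℕ) : pancakeFlip i j = pancakeFun i j := rfl

lemma step_flip (i j : ℕ) (hj : 1 ≤ j) : Step i j (pancakeFlip i j : ℕ) := by
  rw [flip_apply]; unfold pancakeFun Step; split_ifs <;> omega

lemma flip_pos (i j : ℕ) (hj : 1 ≤ j) : 1 ≤ pancakeFlip i j := by
  rw [flip_apply]; unfold pancakeFun; split_ifs <;> omega

lemma flip_flip (i j : ℕ) : pancakeFlip i (pancakeFlip i j) = j := pancakeFun_invol i j

lemma flip_mul_self (i : ℕ) : pancakeFlip i * pancakeFlip i = 1 := by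
  ext j; exact flip_flip i j

lemma flip_inv (i : ℕ) : (pancakeFlip i)⁻¹ = pancakeFlip i := by
  rw [inv_eq_iff_mul_eq_one, flip_mul_self]

lemma W_nil : W [] = 1 := rfl

lemma W_cons (a : ℕ) (l : List ℕ) : W (a :: l) = pancakeFlip a * W l := by
  simp [W]

lemma W_append (l l' : List ℕ) : W (l ++ l') = W l * W l' := by
  simp [W]

lemma W_reverse (l : List ℕ) : W l.reverse = (W l)⁻¹ := by
  induction l with
  | nil => simp [W]
  | cons a l ih => rw [List.reverse_cons, W_append, ih, W_cons a l, mul_inv_rev, W_cons, W_nil, mul_one,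
      flip_inv]

lemma flip_one : pancakeFlip 1 = 1 := by
  ext j
  rw [flip_apply]; unfold pancakeFun; split_ifs
  · simp; omega
  · rfl

lemma chain_append (l l' : List ℕ) (t u w : ℤ) (h : Chain l t u) (h' : Chain l' u w) :
    Chain (l ++ l') t w := by
  induction l generalizing t with
  | nil => obtain rfl : t = u := h; exact h'
  | cons a l ih =>
    obtain ⟨v, hs, hc⟩ := h
    exact ⟨v, hs, ih v hc⟩

lemma W_pos (l : List ℕ) (t : ℕ) (ht : 1 ≤ t) : 1 ≤ W l t := by
  induction l with
  | nil => exact ht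
  | cons a l ih => rw [W_cons]; exact flip_pos _ _ ih

lemma chain_W (l : List ℕ) (t : ℕ) (ht : 1 ≤ t) : Chain l.reverse t (W l t : ℕ) := by
  induction l with
  | nil => exact rfl
  | cons a l ih =>
    rw [List.reverse_cons, W_cons]
    exact chain_append _ _ _ _ _ ih ⟨_, step_flip _ _ (W_pos _ _ ht), rfl⟩

/-- evaluate an equality of words at a point -/
lemma ev {l l' : List ℕ} (h : W l = W l') (t : ℤ) (ht : 1 ≤ t) :
    ∃ w, Chain l.reverse t w ∧ Chain l'.reverse t w := by
  lift t to ℕ using by omega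
  have ht' : 1 ≤ t := by omega
  exact ⟨W l t, chain_W l t ht', h ▸ chain_W l' t ht'⟩

/-- evaluate the inverse of an equality of words at a point -/
lemma evi {l l' : List ℕ} (h : W l = W l') (t : ℤ) (ht : 1 ≤ t) :
    ∃ w, Chain l t w ∧ Chain l' t w := by
  have h' : W l.reverse = W l'.reverse := by rw [W_reverse, W_reverse, h]
  simpa using ev h' t ht

lemma rotR {l l' : List ℕ} {a : ℕ} (h : W (l ++ [a]) = W l') : W l = W (l' ++ [a]) := by
  rw [W_append, ← h, W_append, mul_assoc, W_cons, W_nil, mul_one, flip_mul_self, mul_one]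

lemma rotL {l l' : List ℕ} {a : ℕ} (h : W (a :: l) = W l') : W l = W (a :: l') := by
  rw [W_cons, ← h, W_cons, ← mul_assoc, flip_mul_self, one_mul]

/-- prove an equality of words pointwise -/
lemma W_ext {l l' : List ℕ} (h : ∀ t v w : ℤ, 1 ≤ t → Chain l.reverse t v → Chain l'.reverse t w → v = w) :
    W l = W l' := by
  ext t
  rcases Nat.eq_zero_or_pos t with rfl | ht
  · have : ∀ l, W l 0 = 0 := by
      intro l
      induction l with
      | nil => rfl
      | cons a l ih => rw [W_cons, Equiv.Perm.mul_apply, ih]; rfl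
    rw [this, this]
  · exact_mod_cast h t _ _ (by omega) (chain_W l t ht) (chain_W l' t ht)

/-- excluded words of the shape `m b c d` -/
def exA (b c d : ℕ) : Prop := b = 3 ∧ c = 2 ∧ d = 3
/-- excluded words of the shape `a m c d` -/
def exB (m a c d : ℕ) : Prop :=
  (a + 1 = m ∧ c + 1 = m ∧ d + 2 = m) ∨ (a = 2 ∧ c + 2 = m ∧ d + 1 = m)
/-- excluded words of the shape `a b m d` -/
def exC (m a b d : ℕ) : Prop :=
  (a < d ∧ b + d = m + a) ∨ (a + 1 = m ∧ b + d = m) ∨ (a = 3 ∧ b = 2 ∧ d + 1 = m) ∨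
    (a = 2 ∧ b + 1 = m ∧ d = 2)
/-- excluded words of the shape `a b c m` -/
def exD (m a b c : ℕ) : Prop :=
  (a = c ∧ b < a) ∨ (b + 1 = m ∧ a + c = m) ∨ (a = 2 ∧ b = 3 ∧ c = 2)

/-- a letter that is at least two and below the top letter -/
def Rg (m x : ℕ) : Prop := 2 ≤ x ∧ x < m
/-- two different letters -/
def Df (x y : ℕ) : Prop := x < y ∨ y < x

def TA (m a b c d : ℕ) : Prop :=
  a = m ∧ Rg m b ∧ Rg m c ∧ Rg m d ∧ Df b c ∧ Df c d ∧ ¬ exA b c d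
def TB (m a b c d : ℕ) : Prop :=
  b = m ∧ Rg m a ∧ Rg m c ∧ Rg m d ∧ Df c d ∧ ¬ exB m a c d
def TC (m a b c d : ℕ) : Prop :=
  c = m ∧ Rg m a ∧ Rg m b ∧ Rg m d ∧ Df a b ∧ ¬ exC m a b d
def TD (m a b c d : ℕ) : Prop :=
  d = m ∧ Rg m a ∧ Rg m b ∧ Rg m c ∧ Df a b ∧ Df b c ∧ ¬ exD m a b c
def TE (m a b c d : ℕ) : Prop :=
  a = m ∧ c = m ∧ Rg (m - 1) b ∧ Rg (m - 1) d ∧ (b + d < m ∨ m + 1 < b + d)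
def TF (m a b c d : ℕ) : Prop :=
  b = m ∧ d = m ∧ Rg (m - 1) a ∧ Rg (m - 1) c ∧ m + 1 < a + c
def TG (m a b c d : ℕ) : Prop :=
  a = m ∧ d = m ∧ Rg (m - 1) b ∧ Rg (m - 1) c ∧ (b + 1 < c ∨ c + 1 < b)

/-- normal words of length four with top letter `m` -/
def Nrm (m a b c d : ℕ) : Prop :=
  TA m a b c d ∨ TB m a b c d ∨ TC m a b c d ∨ TD m a b c d ∨ TE m a b c d ∨ TF m a b c d ∨
    TG m a b c d

def S1 (m p q r : ℕ) : Prop := p = m ∧ 1 ≤ q ∧ q < m ∧ 1 ≤ r ∧ r < m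
def S2 (m p q r : ℕ) : Prop := q = m ∧ 2 ≤ p ∧ p < m ∧ 1 ≤ r ∧ r < m
def S3 (m p q r : ℕ) : Prop := r = m ∧ 2 ≤ p ∧ p < m ∧ 2 ≤ q ∧ q < m ∧ Df p q
def S4 (m p q r : ℕ) : Prop := p = m ∧ r = m ∧ 2 ≤ q ∧ q < m

/-- words of length at most three with top letter `m` (padded with ones) -/
def Sht (m p q r : ℕ) : Prop := S1 m p q r ∨ S2 m p q r ∨ S3 m p q r ∨ S4 m p q r

set_option linter.unreachableTactic false
set_option linter.unusedTactic false
set_option linter.unusedVariables false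
set_option linter.style.multiGoal false
set_option linter.unusedSimpArgs false
set_option linter.unnecessarySeqFocus false

set_option maxHeartbeats 0 in
lemma u_top (m a b c d a' b' c' d' : ℕ)
    (g : (TA m a b c d ∧ (TB m a' b' c' d' ∨ TC m a' b' c' d' ∨ TE m a' b' c' d' ∨ TF m a' b' c' d' ∨ TG m a' b' c' d')) ∨
      (TD m a b c d ∧ (TB m a' b' c' d' ∨ TC m a' b' c' d' ∨ TE m a' b' c' d' ∨ TF m a' b' c' d' ∨ TG m a' b' c' d')) ∨
      (TF m a b c d ∧ TF m a' b' c' d') ∨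
      (TG m a b c d ∧ TG m a' b' c' d'))
    (h : W [a, b, c, d] = W [a', b', c', d']) : a = a' ∧ b = b' ∧ c = c' ∧ d = d' := by
  rcases g with ⟨⟨g1, ⟨g2, g3⟩, ⟨g4, g5⟩, ⟨g6, g7⟩, g8 | g8, g9 | g9, gx⟩, (⟨k1, ⟨k2, k3⟩, ⟨k4, k5⟩, ⟨k6, k7⟩, k8 | k8, kx⟩ | ⟨k1, ⟨k2, k3⟩, ⟨k4, k5⟩, ⟨k6, k7⟩, k8 | k8, kx⟩ | ⟨k1, k2, ⟨k3, k4⟩, ⟨k5, k6⟩, k7 | k7⟩ | ⟨k1, k2, ⟨k3, k4⟩, ⟨k5, k6⟩, k7⟩ | ⟨k1, k2, ⟨k3, k4⟩, ⟨k5, k6⟩, k7 | k7⟩)⟩ |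
      ⟨⟨g1, ⟨g2, g3⟩, ⟨g4, g5⟩, ⟨g6, g7⟩, g8 | g8, g9 | g9, gx⟩, (⟨k1, ⟨k2, k3⟩, ⟨k4, k5⟩, ⟨k6, k7⟩, k8 | k8, kx⟩ | ⟨k1, ⟨k2, k3⟩, ⟨k4, k5⟩, ⟨k6, k7⟩, k8 | k8, kx⟩ | ⟨k1, k2, ⟨k3, k4⟩, ⟨k5, k6⟩, k7 | k7⟩ | ⟨k1, k2, ⟨k3, k4⟩, ⟨k5, k6⟩, k7⟩ | ⟨k1, k2, ⟨k3, k4⟩, ⟨k5, k6⟩, k7 | k7⟩)⟩ |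
      ⟨⟨g1, g2, ⟨g3, g4⟩, ⟨g5, g6⟩, g7⟩, ⟨k1, k2, ⟨k3, k4⟩, ⟨k5, k6⟩, k7⟩⟩ |
      ⟨⟨g1, g2, ⟨g3, g4⟩, ⟨g5, g6⟩, g7 | g7⟩, ⟨k1, k2, ⟨k3, k4⟩, ⟨k5, k6⟩, k7 | k7⟩⟩
  all_goals have Q : _ ∧ _ ∧ True := ⟨ev h m (by omega), evi h m (by omega), trivial⟩
  iterate 2
    all_goals obtain ⟨⟨w, H, K⟩, Q⟩ := Q
    iterate 4 (all_goals (obtain ⟨_, ⟨_, rfl⟩ | ⟨_, rfl⟩, H⟩ := H); all_goals try (exfalso; omega))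
    iterate 4 (all_goals (obtain ⟨_, ⟨_, rfl⟩ | ⟨_, rfl⟩, K⟩ := K); all_goals try (exfalso; omega))
    all_goals (rcases H with rfl; change _ = _ at K)
    all_goals try (exfalso; omega)
  all_goals (try simp only [exA, exB, exC, exD] at *) <;> omega


set_option maxHeartbeats 0 in
lemma u_one (m a b c d a' b' c' d' : ℕ)
    (g : (TB m a b c d ∧ (TB m a' b' c' d' ∨ TF m a' b' c' d' ∨ TG m a' b' c' d')) ∨
      (TE m a b c d ∧ (TE m a' b' c' d' ∨ TG m a' b' c' d')) ∨
      (TF m a b c d ∧ TG m a' b' c' d'))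
    (h : W [a, b, c, d] = W [a', b', c', d']) : a = a' ∧ b = b' ∧ c = c' ∧ d = d' := by
  rcases g with ⟨⟨g1, ⟨g2, g3⟩, ⟨g4, g5⟩, ⟨g6, g7⟩, g8 | g8, gx⟩, (⟨k1, ⟨k2, k3⟩, ⟨k4, k5⟩, ⟨k6, k7⟩, k8 | k8, kx⟩ | ⟨k1, k2, ⟨k3, k4⟩, ⟨k5, k6⟩, k7⟩ | ⟨k1, k2, ⟨k3, k4⟩, ⟨k5, k6⟩, k7 | k7⟩)⟩ |
      ⟨⟨g1, g2, ⟨g3, g4⟩, ⟨g5, g6⟩, g7 | g7⟩, (⟨k1, k2, ⟨k3, k4⟩, ⟨k5, k6⟩, k7 | k7⟩ | ⟨k1, k2, ⟨k3, k4⟩, ⟨k5, k6⟩, k7 | k7⟩)⟩ |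
      ⟨⟨g1, g2, ⟨g3, g4⟩, ⟨g5, g6⟩, g7⟩, ⟨k1, k2, ⟨k3, k4⟩, ⟨k5, k6⟩, k7 | k7⟩⟩
  all_goals have Q : _ ∧ _ ∧ _ ∧ _ ∧ True := ⟨ev h m (by omega), evi h m (by omega), ev h 1 (by omega), evi h (a+1) (by omega), trivial⟩
  iterate 4
    all_goals obtain ⟨⟨w, H, K⟩, Q⟩ := Q
    iterate 4 (all_goals (obtain ⟨_, ⟨_, rfl⟩ | ⟨_, rfl⟩, H⟩ := H); all_goals try (exfalso; omega))
    iterate 4 (all_goals (obtain ⟨_, ⟨_, rfl⟩ | ⟨_, rfl⟩, K⟩ := K); all_goals try (exfalso; omega))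
    all_goals (rcases H with rfl; change _ = _ at K)
    all_goals try (exfalso; omega)
  all_goals (try simp only [exA, exB, exC, exD] at *) <;> omega


set_option maxHeartbeats 0 in
lemma u_oneI (m a b c d a' b' c' d' : ℕ)
    (g : TC m a b c d ∧ (TC m a' b' c' d' ∨ TE m a' b' c' d' ∨ TF m a' b' c' d'))
    (h : W [a, b, c, d] = W [a', b', c', d']) : a = a' ∧ b = b' ∧ c = c' ∧ d = d' := by
  rcases g with ⟨⟨g1, ⟨g2, g3⟩, ⟨g4, g5⟩, ⟨g6, g7⟩, g8 | g8, gx⟩, (⟨k1, ⟨k2, k3⟩, ⟨k4, k5⟩, ⟨k6, k7⟩, k8 | k8, kx⟩ | ⟨k1, k2, ⟨k3, k4⟩, ⟨k5, k6⟩, k7 | k7⟩ | ⟨k1, k2, ⟨k3, k4⟩, ⟨k5, k6⟩, k7⟩)⟩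
  all_goals have Q : _ ∧ _ ∧ _ ∧ _ ∧ True := ⟨ev h m (by omega), evi h m (by omega), evi h 1 (by omega), evi h (a+1) (by omega), trivial⟩
  iterate 4
    all_goals obtain ⟨⟨w, H, K⟩, Q⟩ := Q
    iterate 4 (all_goals (obtain ⟨_, ⟨_, rfl⟩ | ⟨_, rfl⟩, H⟩ := H); all_goals try (exfalso; omega))
    iterate 4 (all_goals (obtain ⟨_, ⟨_, rfl⟩ | ⟨_, rfl⟩, K⟩ := K); all_goals try (exfalso; omega))
    all_goals (rcases H with rfl; change _ = _ at K)
    all_goals try (exfalso; omega)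
  all_goals (try simp only [exA, exB, exC, exD] at *) <;> omega


set_option maxHeartbeats 0 in
lemma u_AA (m a b c d a' b' c' d' : ℕ)
    (g : TA m a b c d ∧ TA m a' b' c' d')
    (h : W [a, b, c, d] = W [a', b', c', d']) : a = a' ∧ b = b' ∧ c = c' ∧ d = d' := by
  rcases g with ⟨⟨g1, ⟨g2, g3⟩, ⟨g4, g5⟩, ⟨g6, g7⟩, g8 | g8, g9 | g9, gx⟩, ⟨k1, ⟨k2, k3⟩, ⟨k4, k5⟩, ⟨k6, k7⟩, k8 | k8, k9 | k9, kx⟩⟩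
  all_goals have Q : _ ∧ _ ∧ _ ∧ _ ∧ _ ∧ True := ⟨ev h m (by omega), evi h m (by omega), ev h (d) (by omega), ev h (d') (by omega), evi h (m-1) (by omega), trivial⟩
  iterate 5
    all_goals obtain ⟨⟨w, H, K⟩, Q⟩ := Q
    iterate 4 (all_goals (obtain ⟨_, ⟨_, rfl⟩ | ⟨_, rfl⟩, H⟩ := H); all_goals try (exfalso; omega))
    iterate 4 (all_goals (obtain ⟨_, ⟨_, rfl⟩ | ⟨_, rfl⟩, K⟩ := K); all_goals try (exfalso; omega))
    all_goals (rcases H with rfl; change _ = _ at K)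
    all_goals try (exfalso; omega)
  all_goals (try simp only [exA, exB, exC, exD] at *) <;> omega


set_option maxHeartbeats 0 in
lemma u_DD (m a b c d a' b' c' d' : ℕ)
    (g : TD m a b c d ∧ TD m a' b' c' d')
    (h : W [a, b, c, d] = W [a', b', c', d']) : a = a' ∧ b = b' ∧ c = c' ∧ d = d' := by
  rcases g with ⟨⟨g1, ⟨g2, g3⟩, ⟨g4, g5⟩, ⟨g6, g7⟩, g8 | g8, g9 | g9, gx⟩, ⟨k1, ⟨k2, k3⟩, ⟨k4, k5⟩, ⟨k6, k7⟩, k8 | k8, k9 | k9, kx⟩⟩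
  all_goals have Q : _ ∧ _ ∧ _ ∧ _ ∧ True := ⟨ev h m (by omega), evi h m (by omega), evi h (a) (by omega), evi h (a') (by omega), trivial⟩
  iterate 4
    all_goals obtain ⟨⟨w, H, K⟩, Q⟩ := Q
    iterate 4 (all_goals (obtain ⟨_, ⟨_, rfl⟩ | ⟨_, rfl⟩, H⟩ := H); all_goals try (exfalso; omega))
    iterate 4 (all_goals (obtain ⟨_, ⟨_, rfl⟩ | ⟨_, rfl⟩, K⟩ := K); all_goals try (exfalso; omega))
    all_goals (rcases H with rfl; change _ = _ at K)
    all_goals try (exfalso; omega)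
  all_goals (try simp only [exA, exB, exC, exD] at *) <;> omega


set_option maxHeartbeats 0 in
lemma u_AD (m a b c d a' b' c' d' : ℕ)
    (g : TA m a b c d ∧ TD m a' b' c' d')
    (h : W [a, b, c, d] = W [a', b', c', d']) : a = a' ∧ b = b' ∧ c = c' ∧ d = d' := by
  rcases g with ⟨⟨g1, ⟨g2, g3⟩, ⟨g4, g5⟩, ⟨g6, g7⟩, g8 | g8, g9 | g9, gx⟩, ⟨k1, ⟨k2, k3⟩, ⟨k4, k5⟩, ⟨k6, k7⟩, k8 | k8, k9 | k9, kx⟩⟩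
  all_goals have Q : _ ∧ _ ∧ _ ∧ _ ∧ True := ⟨ev h m (by omega), evi h m (by omega), ev h (m-1) (by omega), evi h (c) (by omega), trivial⟩
  iterate 4
    all_goals obtain ⟨⟨w, H, K⟩, Q⟩ := Q
    iterate 4 (all_goals (obtain ⟨_, ⟨_, rfl⟩ | ⟨_, rfl⟩, H⟩ := H); all_goals try (exfalso; omega))
    iterate 4 (all_goals (obtain ⟨_, ⟨_, rfl⟩ | ⟨_, rfl⟩, K⟩ := K); all_goals try (exfalso; omega))
    all_goals (rcases H with rfl; change _ = _ at K)
    all_goals try (exfalso; omega)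
  all_goals (try simp only [exA, exB, exC, exD] at *) <;> omega


set_option maxHeartbeats 0 in
lemma u_BC (m a b c d a' b' c' d' : ℕ)
    (g : TB m a b c d ∧ TC m a' b' c' d')
    (h : W [a, b, c, d] = W [a', b', c', d']) : a = a' ∧ b = b' ∧ c = c' ∧ d = d' := by
  rcases g with ⟨⟨g1, ⟨g2, g3⟩, ⟨g4, g5⟩, ⟨g6, g7⟩, g8 | g8, gx⟩, ⟨k1, ⟨k2, k3⟩, ⟨k4, k5⟩, ⟨k6, k7⟩, k8 | k8, kx⟩⟩
  all_goals have Q : _ ∧ _ ∧ _ ∧ _ ∧ _ ∧ _ ∧ True := ⟨ev h m (by omega), evi h m (by omega), evi h (a') (by omega), evi h 1 (by omega), evi h (a+1) (by omega), ev h 1 (by omega), trivial⟩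
  iterate 6
    all_goals obtain ⟨⟨w, H, K⟩, Q⟩ := Q
    iterate 4 (all_goals (obtain ⟨_, ⟨_, rfl⟩ | ⟨_, rfl⟩, H⟩ := H); all_goals try (exfalso; omega))
    iterate 4 (all_goals (obtain ⟨_, ⟨_, rfl⟩ | ⟨_, rfl⟩, K⟩ := K); all_goals try (exfalso; omega))
    all_goals (rcases H with rfl; change _ = _ at K)
    all_goals try (exfalso; omega)
  all_goals (try simp only [exA, exB, exC, exD] at *) <;> omega


set_option maxHeartbeats 0 in
lemma u_BE (m a b c d a' b' c' d' : ℕ)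
    (g : TB m a b c d ∧ TE m a' b' c' d')
    (h : W [a, b, c, d] = W [a', b', c', d']) : a = a' ∧ b = b' ∧ c = c' ∧ d = d' := by
  rcases g with ⟨⟨g1, ⟨g2, g3⟩, ⟨g4, g5⟩, ⟨g6, g7⟩, g8 | g8, gx⟩, ⟨k1, k2, ⟨k3, k4⟩, ⟨k5, k6⟩, k7 | k7⟩⟩
  all_goals have Q : _ ∧ _ ∧ _ ∧ _ ∧ True := ⟨ev h m (by omega), evi h m (by omega), evi h (d'+1) (by omega), ev h 1 (by omega), trivial⟩
  iterate 4
    all_goals obtain ⟨⟨w, H, K⟩, Q⟩ := Q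
    iterate 4 (all_goals (obtain ⟨_, ⟨_, rfl⟩ | ⟨_, rfl⟩, H⟩ := H); all_goals try (exfalso; omega))
    iterate 4 (all_goals (obtain ⟨_, ⟨_, rfl⟩ | ⟨_, rfl⟩, K⟩ := K); all_goals try (exfalso; omega))
    all_goals (rcases H with rfl; change _ = _ at K)
    all_goals try (exfalso; omega)
  all_goals (try simp only [exA, exB, exC, exD] at *) <;> omega


set_option maxHeartbeats 0 in
lemma u_CG (m a b c d a' b' c' d' : ℕ)
    (g : TC m a b c d ∧ TG m a' b' c' d')
    (h : W [a, b, c, d] = W [a', b', c', d']) : a = a' ∧ b = b' ∧ c = c' ∧ d = d' := by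
  rcases g with ⟨⟨g1, ⟨g2, g3⟩, ⟨g4, g5⟩, ⟨g6, g7⟩, g8 | g8, gx⟩, ⟨k1, k2, ⟨k3, k4⟩, ⟨k5, k6⟩, k7 | k7⟩⟩
  all_goals have Q : _ ∧ _ ∧ _ ∧ _ ∧ True := ⟨ev h m (by omega), evi h m (by omega), ev h 1 (by omega), ev h (2) (by omega), trivial⟩
  iterate 4
    all_goals obtain ⟨⟨w, H, K⟩, Q⟩ := Q
    iterate 4 (all_goals (obtain ⟨_, ⟨_, rfl⟩ | ⟨_, rfl⟩, H⟩ := H); all_goals try (exfalso; omega))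
    iterate 4 (all_goals (obtain ⟨_, ⟨_, rfl⟩ | ⟨_, rfl⟩, K⟩ := K); all_goals try (exfalso; omega))
    all_goals (rcases H with rfl; change _ = _ at K)
    all_goals try (exfalso; omega)
  all_goals (try simp only [exA, exB, exC, exD] at *) <;> omega


set_option maxHeartbeats 0 in
lemma u_EF (m a b c d a' b' c' d' : ℕ)
    (g : TE m a b c d ∧ TF m a' b' c' d')
    (h : W [a, b, c, d] = W [a', b', c', d']) : a = a' ∧ b = b' ∧ c = c' ∧ d = d' := by
  rcases g with ⟨⟨g1, g2, ⟨g3, g4⟩, ⟨g5, g6⟩, g7 | g7⟩, ⟨k1, k2, ⟨k3, k4⟩, ⟨k5, k6⟩, k7⟩⟩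
  all_goals have Q : _ ∧ _ ∧ _ ∧ True := ⟨ev h m (by omega), evi h m (by omega), ev h (m-1) (by omega), trivial⟩
  iterate 3
    all_goals obtain ⟨⟨w, H, K⟩, Q⟩ := Q
    iterate 4 (all_goals (obtain ⟨_, ⟨_, rfl⟩ | ⟨_, rfl⟩, H⟩ := H); all_goals try (exfalso; omega))
    iterate 4 (all_goals (obtain ⟨_, ⟨_, rfl⟩ | ⟨_, rfl⟩, K⟩ := K); all_goals try (exfalso; omega))
    all_goals (rcases H with rfl; change _ = _ at K)
    all_goals try (exfalso; omega)
  all_goals (try simp only [exA, exB, exC, exD] at *) <;> omega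


set_option maxHeartbeats 0 in
lemma s_top (m a b c d a' b' c' : ℕ)
    (g : (TA m a b c d ∧ (S2 m a' b' c' ∨ S3 m a' b' c' ∨ S4 m a' b' c')) ∨
      ((TB m a b c d ∨ TC m a b c d ∨ TE m a b c d ∨ TF m a b c d ∨ TG m a b c d) ∧ (S1 m a' b' c' ∨ S3 m a' b' c')) ∨
      ((TD m a b c d ∨ TG m a b c d) ∧ S4 m a' b' c'))
    (h : W [a, b, c, d] = W [a', b', c']) : False := by
  rcases g with ⟨⟨g1, ⟨g2, g3⟩, ⟨g4, g5⟩, ⟨g6, g7⟩, g8 | g8, g9 | g9, gx⟩, (⟨k1, k2, k3, k4, k5⟩ | ⟨k1, k2, k3, k4, k5, k6 | k6⟩ | ⟨k1, k2, k3, k4⟩)⟩ |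
      ⟨(⟨g1, ⟨g2, g3⟩, ⟨g4, g5⟩, ⟨g6, g7⟩, g8 | g8, gx⟩ | ⟨g1, ⟨g2, g3⟩, ⟨g4, g5⟩, ⟨g6, g7⟩, g8 | g8, gx⟩ | ⟨g1, g2, ⟨g3, g4⟩, ⟨g5, g6⟩, g7 | g7⟩ | ⟨g1, g2, ⟨g3, g4⟩, ⟨g5, g6⟩, g7⟩ | ⟨g1, g2, ⟨g3, g4⟩, ⟨g5, g6⟩, g7 | g7⟩), (⟨k1, k2, k3, k4, k5⟩ | ⟨k1, k2, k3, k4, k5, k6 | k6⟩)⟩ |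
      ⟨(⟨g1, ⟨g2, g3⟩, ⟨g4, g5⟩, ⟨g6, g7⟩, g8 | g8, g9 | g9, gx⟩ | ⟨g1, g2, ⟨g3, g4⟩, ⟨g5, g6⟩, g7 | g7⟩), ⟨k1, k2, k3, k4⟩⟩
  all_goals have Q : _ ∧ _ ∧ True := ⟨ev h m (by omega), evi h m (by omega), trivial⟩
  iterate 2
    all_goals obtain ⟨⟨w, H, K⟩, Q⟩ := Q
    iterate 4 (all_goals (obtain ⟨_, ⟨_, rfl⟩ | ⟨_, rfl⟩, H⟩ := H); all_goals try (exfalso; omega))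
    iterate 3 (all_goals (obtain ⟨_, ⟨_, rfl⟩ | ⟨_, rfl⟩, K⟩ := K); all_goals try (exfalso; omega))
    all_goals (rcases H with rfl; change _ = _ at K)
    all_goals try (exfalso; omega)
  all_goals (try simp only [exA, exB, exC, exD] at *) <;> omega


set_option maxHeartbeats 0 in
lemma s_one (m a b c d a' b' c' : ℕ)
    (g : ((TB m a b c d ∨ TE m a b c d) ∧ (S2 m a' b' c' ∨ S4 m a' b' c')) ∨
      (TF m a b c d ∧ S4 m a' b' c'))
    (h : W [a, b, c, d] = W [a', b', c']) : False := by
  rcases g with ⟨(⟨g1, ⟨g2, g3⟩, ⟨g4, g5⟩, ⟨g6, g7⟩, g8 | g8, gx⟩ | ⟨g1, g2, ⟨g3, g4⟩, ⟨g5, g6⟩, g7 | g7⟩), (⟨k1, k2, k3, k4, k5⟩ | ⟨k1, k2, k3, k4⟩)⟩ |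
      ⟨⟨g1, g2, ⟨g3, g4⟩, ⟨g5, g6⟩, g7⟩, ⟨k1, k2, k3, k4⟩⟩
  all_goals have Q : _ ∧ _ ∧ _ ∧ _ ∧ True := ⟨ev h m (by omega), evi h m (by omega), ev h 1 (by omega), ev h (d+1) (by omega), trivial⟩
  iterate 4
    all_goals obtain ⟨⟨w, H, K⟩, Q⟩ := Q
    iterate 4 (all_goals (obtain ⟨_, ⟨_, rfl⟩ | ⟨_, rfl⟩, H⟩ := H); all_goals try (exfalso; omega))
    iterate 3 (all_goals (obtain ⟨_, ⟨_, rfl⟩ | ⟨_, rfl⟩, K⟩ := K); all_goals try (exfalso; omega))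
    all_goals (rcases H with rfl; change _ = _ at K)
    all_goals try (exfalso; omega)
  all_goals (try simp only [exA, exB, exC, exD] at *) <;> omega


set_option maxHeartbeats 0 in
lemma s_oneI (m a b c d a' b' c' : ℕ)
    (g : (TC m a b c d ∧ S2 m a' b' c') ∨
      (TD m a b c d ∧ (S2 m a' b' c' ∨ S3 m a' b' c')))
    (h : W [a, b, c, d] = W [a', b', c']) : False := by
  rcases g with ⟨⟨g1, ⟨g2, g3⟩, ⟨g4, g5⟩, ⟨g6, g7⟩, g8 | g8, gx⟩, ⟨k1, k2, k3, k4, k5⟩⟩ |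
      ⟨⟨g1, ⟨g2, g3⟩, ⟨g4, g5⟩, ⟨g6, g7⟩, g8 | g8, g9 | g9, gx⟩, (⟨k1, k2, k3, k4, k5⟩ | ⟨k1, k2, k3, k4, k5, k6 | k6⟩)⟩
  all_goals have Q : _ ∧ _ ∧ _ ∧ _ ∧ True := ⟨ev h m (by omega), evi h m (by omega), evi h 1 (by omega), evi h (a) (by omega), trivial⟩
  iterate 4
    all_goals obtain ⟨⟨w, H, K⟩, Q⟩ := Q
    iterate 4 (all_goals (obtain ⟨_, ⟨_, rfl⟩ | ⟨_, rfl⟩, H⟩ := H); all_goals try (exfalso; omega))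
    iterate 3 (all_goals (obtain ⟨_, ⟨_, rfl⟩ | ⟨_, rfl⟩, K⟩ := K); all_goals try (exfalso; omega))
    all_goals (rcases H with rfl; change _ = _ at K)
    all_goals try (exfalso; omega)
  all_goals (try simp only [exA, exB, exC, exD] at *) <;> omega


set_option maxHeartbeats 0 in
lemma s_AS (m a b c d a' b' c' : ℕ)
    (g : TA m a b c d ∧ S1 m a' b' c')
    (h : W [a, b, c, d] = W [a', b', c']) : False := by
  rcases g with ⟨⟨g1, ⟨g2, g3⟩, ⟨g4, g5⟩, ⟨g6, g7⟩, g8 | g8, g9 | g9, gx⟩, ⟨k1, k2, k3, k4, k5⟩⟩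
  all_goals have Q : _ ∧ _ ∧ _ ∧ _ ∧ True := ⟨ev h m (by omega), evi h m (by omega), ev h (d) (by omega), ev h 1 (by omega), trivial⟩
  iterate 4
    all_goals obtain ⟨⟨w, H, K⟩, Q⟩ := Q
    iterate 4 (all_goals (obtain ⟨_, ⟨_, rfl⟩ | ⟨_, rfl⟩, H⟩ := H); all_goals try (exfalso; omega))
    iterate 3 (all_goals (obtain ⟨_, ⟨_, rfl⟩ | ⟨_, rfl⟩, K⟩ := K); all_goals try (exfalso; omega))
    all_goals (rcases H with rfl; change _ = _ at K)
    all_goals try (exfalso; omega)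
  all_goals (try simp only [exA, exB, exC, exD] at *) <;> omega


set_option maxHeartbeats 0 in
lemma s_DS (m a b c d a' b' c' : ℕ)
    (g : TD m a b c d ∧ S1 m a' b' c')
    (h : W [a, b, c, d] = W [a', b', c']) : False := by
  rcases g with ⟨⟨g1, ⟨g2, g3⟩, ⟨g4, g5⟩, ⟨g6, g7⟩, g8 | g8, g9 | g9, gx⟩, ⟨k1, k2, k3, k4, k5⟩⟩
  all_goals have Q : _ ∧ _ ∧ _ ∧ True := ⟨ev h m (by omega), evi h m (by omega), ev h (m-1) (by omega), trivial⟩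
  iterate 3
    all_goals obtain ⟨⟨w, H, K⟩, Q⟩ := Q
    iterate 4 (all_goals (obtain ⟨_, ⟨_, rfl⟩ | ⟨_, rfl⟩, H⟩ := H); all_goals try (exfalso; omega))
    iterate 3 (all_goals (obtain ⟨_, ⟨_, rfl⟩ | ⟨_, rfl⟩, K⟩ := K); all_goals try (exfalso; omega))
    all_goals (rcases H with rfl; change _ = _ at K)
    all_goals try (exfalso; omega)
  all_goals (try simp only [exA, exB, exC, exD] at *) <;> omega


set_option maxHeartbeats 0 in
lemma s_FG (m a b c d a' b' c' : ℕ)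
    (g : ((TF m a b c d ∨ TG m a b c d) ∧ S2 m a' b' c') ∨
      (TC m a b c d ∧ S4 m a' b' c'))
    (h : W [a, b, c, d] = W [a', b', c']) : False := by
  rcases g with ⟨(⟨g1, g2, ⟨g3, g4⟩, ⟨g5, g6⟩, g7⟩ | ⟨g1, g2, ⟨g3, g4⟩, ⟨g5, g6⟩, g7 | g7⟩), ⟨k1, k2, k3, k4, k5⟩⟩ |
      ⟨⟨g1, ⟨g2, g3⟩, ⟨g4, g5⟩, ⟨g6, g7⟩, g8 | g8, gx⟩, ⟨k1, k2, k3, k4⟩⟩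
  all_goals have Q : _ ∧ _ ∧ _ ∧ _ ∧ _ ∧ True := ⟨ev h m (by omega), evi h m (by omega), ev h 1 (by omega), evi h (m-1) (by omega), evi h (a'+1) (by omega), trivial⟩
  iterate 5
    all_goals obtain ⟨⟨w, H, K⟩, Q⟩ := Q
    iterate 4 (all_goals (obtain ⟨_, ⟨_, rfl⟩ | ⟨_, rfl⟩, H⟩ := H); all_goals try (exfalso; omega))
    iterate 3 (all_goals (obtain ⟨_, ⟨_, rfl⟩ | ⟨_, rfl⟩, K⟩ := K); all_goals try (exfalso; omega))
    all_goals (rcases H with rfl; change _ = _ at K)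
    all_goals try (exfalso; omega)
  all_goals (try simp only [exA, exB, exC, exD] at *) <;> omega


lemma fix_top (l : List ℕ) (m t : ℕ) (hl : ∀ x ∈ l, x ≤ m) (ht : m < t) : W l t = t := by
  induction l with
  | nil => rfl
  | cons a l ih =>
    rw [W_cons, Equiv.Perm.mul_apply, ih (fun x hx => hl x (by simp [hx])), flip_apply]
    have := hl a (by simp)
    unfold pancakeFun; split_ifs <;> omega

lemma nrm_letters {m a b c d : ℕ} (g : Nrm m a b c d) :
    (2 ≤ a ∧ a ≤ m) ∧ (2 ≤ b ∧ b ≤ m) ∧ (2 ≤ c ∧ c ≤ m) ∧ 2 ≤ d ∧ d ≤ m := by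
  simp only [Nrm, TA, TB, TC, TD, TE, TF, TG, Rg] at g
  omega

lemma nrm_moves {m a b c d : ℕ} (g : Nrm m a b c d) : W [a, b, c, d] m ≠ m := by
  intro h
  have hm := nrm_letters g
  have H := chain_W [a, b, c, d] m (by omega)
  rw [h] at H
  clear h
  rcases g with (⟨g1, ⟨g2, g3⟩, ⟨g4, g5⟩, ⟨g6, g7⟩, g8 | g8, g9 | g9, gx⟩ | ⟨g1, ⟨g2, g3⟩, ⟨g4, g5⟩, ⟨g6, g7⟩, g8 | g8, gx⟩ | ⟨g1, ⟨g2, g3⟩, ⟨g4, g5⟩, ⟨g6, g7⟩, g8 | g8, gx⟩ | ⟨g1, ⟨g2, g3⟩, ⟨g4, g5⟩, ⟨g6, g7⟩, g8 | g8, g9 | g9, gx⟩ | ⟨g1, g2, ⟨g3, g4⟩, ⟨g5, g6⟩, g7 | g7⟩ | ⟨g1, g2, ⟨g3, g4⟩, ⟨g5, g6⟩, g7⟩ | ⟨g1, g2, ⟨g3, g4⟩, ⟨g5, g6⟩, g7 | g7⟩)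
  iterate 4 (all_goals (obtain ⟨_, ⟨_, rfl⟩ | ⟨_, rfl⟩, H⟩ := H); all_goals try (exfalso; omega))
  all_goals (change _ = _ at H; omega)

lemma sht_letters {m a b c : ℕ} (g : Sht m a b c) :
    2 ≤ m ∧ (1 ≤ a ∧ a ≤ m) ∧ (1 ≤ b ∧ b ≤ m) ∧ 1 ≤ c ∧ c ≤ m := by
  simp only [Sht, S1, S2, S3, S4] at g
  omega

lemma sht_moves {m a b c : ℕ} (g : Sht m a b c) : W [a, b, c] m ≠ m := by
  intro h
  have hm := sht_letters g
  have H := chain_W [a, b, c] m (by omega)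
  rw [h] at H
  clear h
  rcases g with (⟨g1, g2, g3, g4, g5⟩ | ⟨g1, g2, g3, g4, g5⟩ | ⟨g1, g2, g3, g4, g5, g6 | g6⟩ | ⟨g1, g2, g3, g4⟩)
  iterate 3 (all_goals (obtain ⟨_, ⟨_, rfl⟩ | ⟨_, rfl⟩, H⟩ := H); all_goals try (exfalso; omega))
  all_goals (change _ = _ at H; omega)

lemma uniq_same {m a b c d a' b' c' d' : ℕ} (g : Nrm m a b c d) (g' : Nrm m a' b' c' d')
    (h : W [a, b, c, d] = W [a', b', c', d']) : a = a' ∧ b = b' ∧ c = c' ∧ d = d' := by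
  have k : a' = a ∧ b' = b ∧ c' = c ∧ d' = d → a = a' ∧ b = b' ∧ c = c' ∧ d = d' := by omega
  rcases g with g | g | g | g | g | g | g <;> rcases g' with g' | g' | g' | g' | g' | g' | g'
  all_goals first
    | (refine u_top m _ _ _ _ _ _ _ _ ?_ h; simp only [g, g', true_or, or_true, and_self]; done)
    | (refine k (u_top m _ _ _ _ _ _ _ _ ?_ h.symm); simp only [g, g', true_or, or_true, and_self]; done)
    | (refine u_one m _ _ _ _ _ _ _ _ ?_ h; simp only [g, g', true_or, or_true, and_self]; done)
    | (refine k (u_one m _ _ _ _ _ _ _ _ ?_ h.symm); simp only [g, g', true_or, or_true, and_self]; done)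
    | (refine u_oneI m _ _ _ _ _ _ _ _ ?_ h; simp only [g, g', true_or, or_true, and_self]; done)
    | (refine k (u_oneI m _ _ _ _ _ _ _ _ ?_ h.symm); simp only [g, g', true_or, or_true, and_self]; done)
    | (refine u_AA m _ _ _ _ _ _ _ _ ?_ h; simp only [g, g', true_or, or_true, and_self]; done)
    | (refine k (u_AA m _ _ _ _ _ _ _ _ ?_ h.symm); simp only [g, g', true_or, or_true, and_self]; done)
    | (refine u_DD m _ _ _ _ _ _ _ _ ?_ h; simp only [g, g', true_or, or_true, and_self]; done)
    | (refine k (u_DD m _ _ _ _ _ _ _ _ ?_ h.symm); simp only [g, g', true_or, or_true, and_self]; done)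
    | (refine u_AD m _ _ _ _ _ _ _ _ ?_ h; simp only [g, g', true_or, or_true, and_self]; done)
    | (refine k (u_AD m _ _ _ _ _ _ _ _ ?_ h.symm); simp only [g, g', true_or, or_true, and_self]; done)
    | (refine u_BC m _ _ _ _ _ _ _ _ ?_ h; simp only [g, g', true_or, or_true, and_self]; done)
    | (refine k (u_BC m _ _ _ _ _ _ _ _ ?_ h.symm); simp only [g, g', true_or, or_true, and_self]; done)
    | (refine u_BE m _ _ _ _ _ _ _ _ ?_ h; simp only [g, g', true_or, or_true, and_self]; done)
    | (refine k (u_BE m _ _ _ _ _ _ _ _ ?_ h.symm); simp only [g, g', true_or, or_true, and_self]; done)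
    | (refine u_CG m _ _ _ _ _ _ _ _ ?_ h; simp only [g, g', true_or, or_true, and_self]; done)
    | (refine k (u_CG m _ _ _ _ _ _ _ _ ?_ h.symm); simp only [g, g', true_or, or_true, and_self]; done)
    | (refine u_EF m _ _ _ _ _ _ _ _ ?_ h; simp only [g, g', true_or, or_true, and_self]; done)
    | (refine k (u_EF m _ _ _ _ _ _ _ _ ?_ h.symm); simp only [g, g', true_or, or_true, and_self]; done)

lemma not_short_same {m a b c d p q r : ℕ} (g : Nrm m a b c d) (g' : Sht m p q r)
    (h : W [a, b, c, d] = W [p, q, r]) : False := by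
  rcases g with g | g | g | g | g | g | g <;> rcases g' with g' | g' | g' | g'
  all_goals first
    | (refine s_top m _ _ _ _ _ _ _ ?_ h; simp only [g, g', true_or, or_true, and_self]; done)
    | (refine s_one m _ _ _ _ _ _ _ ?_ h; simp only [g, g', true_or, or_true, and_self]; done)
    | (refine s_oneI m _ _ _ _ _ _ _ ?_ h; simp only [g, g', true_or, or_true, and_self]; done)
    | (refine s_AS m _ _ _ _ _ _ _ ?_ h; simp only [g, g', true_or, or_true, and_self]; done)
    | (refine s_DS m _ _ _ _ _ _ _ ?_ h; simp only [g, g', true_or, or_true, and_self]; done)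
    | (refine s_FG m _ _ _ _ _ _ _ ?_ h; simp only [g, g', true_or, or_true, and_self]; done)

/-- normal words represent different permutations -/
theorem uniq {m m' a b c d a' b' c' d' : ℕ} (g : Nrm m a b c d) (g' : Nrm m' a' b' c' d')
    (h : W [a, b, c, d] = W [a', b', c', d']) : a = a' ∧ b = b' ∧ c = c' ∧ d = d' := by
  have e := nrm_letters g
  have e' := nrm_letters g'
  rcases lt_trichotomy m m' with hm | rfl | hm
  · exact absurd (h ▸ fix_top [a, b, c, d] m m' (by simp; omega) hm) (nrm_moves g')
  · exact uniq_same g g' h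
  · exact absurd (h ▸ fix_top [a', b', c', d'] m' m (by simp; omega) hm) (nrm_moves g)

/-- normal words are not equal to short words -/
theorem not_short {m m' a b c d p q r : ℕ} (g : Nrm m a b c d) (g' : Sht m' p q r)
    (h : W [a, b, c, d] = W [p, q, r]) : False := by
  have e := nrm_letters g
  have e' := sht_letters g'
  rcases lt_trichotomy m m' with hm | rfl | hm
  · exact absurd (h ▸ fix_top [a, b, c, d] m m' (by simp; omega) hm) (sht_moves g')
  · exact not_short_same g g' h
  · exact absurd (h ▸ fix_top [p, q, r] m' m (by simp; omega) hm) (nrm_moves g)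

/-- the permutation is given by a normal word or by a short word, with letters up to `m` -/
def Cp (m : ℕ) (π : Equiv.Perm ℕ) : Prop :=
  (∃ a b c d, Nrm m a b c d ∧ W [a, b, c, d] = π) ∨
    ∃ p q r, (1 ≤ p ∧ p ≤ m) ∧ (1 ≤ q ∧ q ≤ m) ∧ (1 ≤ r ∧ r ≤ m) ∧ W [p, q, r] = π

lemma cong {m : ℕ} {l l' : List ℕ} (h : W l = W l') (c : Cp m (W l')) : Cp m (W l) := h ▸ c

/-- a letter that is allowed in a word that need not be reduced -/
abbrev Lt1 (m x : ℕ) : Prop := 1 ≤ x ∧ x ≤ m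

lemma W_one (l : List ℕ) : W (1 :: l) = W l := by rw [W_cons, flip_one, one_mul]

lemma W_dup (a : ℕ) (l : List ℕ) : W (a :: a :: l) = W l := by
  rw [W_cons, W_cons, ← mul_assoc, flip_mul_self, one_mul]

/-- words that are visibly not reduced -/
lemma comp_drop (m a b c d : ℕ) (e : Lt1 m a ∧ Lt1 m b ∧ Lt1 m c ∧ Lt1 m d)
    (h : a = 1 ∨ b = 1 ∨ c = 1 ∨ d = 1 ∨ a = b ∨ b = c ∨ c = d) : Cp m (W [a, b, c, d]) := by
  obtain ⟨ha, hb, hc, hd⟩ := e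
  have h1 : Lt1 m 1 := ⟨le_rfl, ha.1.trans ha.2⟩
  right
  rcases h with rfl | rfl | rfl | rfl | rfl | rfl | rfl
  · exact ⟨b, c, d, hb, hc, hd, (W_one _).symm⟩
  · exact ⟨a, c, d, ha, hc, hd, by rw [W_cons a, W_cons a, W_one]⟩
  · exact ⟨a, b, d, ha, hb, hd, by rw [W_cons a, W_cons b, W_cons a, W_cons b, W_one]⟩
  · exact ⟨a, b, c, ha, hb, hc, by
      rw [W_cons a, W_cons b, W_cons c, W_cons a, W_cons b, W_cons c, W_one]⟩
  · exact ⟨1, c, d, h1, hc, hd, by rw [W_one, W_dup]⟩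
  · exact ⟨1, a, d, h1, ha, hd, by rw [W_one, W_cons a (b :: _), W_dup, ← W_cons]⟩
  · exact ⟨1, a, b, h1, ha, hb, by rw [W_one, W_cons a [b, c, c], W_cons b [c, c], W_dup,
      ← W_cons, ← W_cons]⟩


lemma compA (m b c d : ℕ) (hb : 1 ≤ b ∧ b < m) (hc : 1 ≤ c ∧ c < m) (hd : 1 ≤ d ∧ d < m) :
    Cp m (W [m, b, c, d]) := by
  by_cases h : m = 1 ∨ b = 1 ∨ c = 1 ∨ d = 1 ∨ m = b ∨ b = c ∨ c = d
  · exact comp_drop m _ _ _ _ (by unfold Lt1; omega) h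
  by_cases hx : exA b c d
  swap
  · refine .inl ⟨_, _, _, _, .inl ?_, rfl⟩
    simp only [TA, Rg, Df, hx, true_and, not_false_eq_true, and_true]; omega
  unfold exA at hx
  refine cong ?_ (.inl ⟨m, 2, 3, 2, .inl (by norm_num [TA, Rg, Df, exA]; omega), rfl⟩)
  rotate_left
  all_goals (apply W_ext; intro t v w ht H K)
  iterate 4 (all_goals (obtain ⟨_, ⟨_, rfl⟩ | ⟨_, rfl⟩, H⟩ := H); all_goals try (exfalso; omega))
  iterate 4 (all_goals (obtain ⟨_, ⟨_, rfl⟩ | ⟨_, rfl⟩, K⟩ := K); all_goals try (exfalso; omega))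
  all_goals (change _ = _ at H; change _ = _ at K; omega)

lemma compB (m a c d : ℕ) (ha : 1 ≤ a ∧ a < m) (hc : 1 ≤ c ∧ c < m) (hd : 1 ≤ d ∧ d < m) :
    Cp m (W [a, m, c, d]) := by
  by_cases h : a = 1 ∨ m = 1 ∨ c = 1 ∨ d = 1 ∨ a = m ∨ m = c ∨ c = d
  · exact comp_drop m _ _ _ _ (by unfold Lt1; omega) h
  by_cases hx : exB m a c d
  swap
  · refine .inl ⟨_, _, _, _, .inr (.inl ?_), rfl⟩
    simp only [TB, Rg, Df, hx, true_and, not_false_eq_true, and_true]; omega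
  unfold exB at hx
  rcases hx with hx | hx
  refine cong (l' := [m, 2, m, 1]) ?_ (comp_drop m _ _ _ _ (by unfold Lt1; omega) (by omega))
  rotate_left
  refine cong (l' := [m, m - 1, m, 1]) ?_ (comp_drop m _ _ _ _ (by unfold Lt1; omega) (by omega))
  rotate_left
  all_goals (apply W_ext; intro t v w ht H K)
  iterate 4 (all_goals (obtain ⟨_, ⟨_, rfl⟩ | ⟨_, rfl⟩, H⟩ := H); all_goals try (exfalso; omega))
  iterate 4 (all_goals (obtain ⟨_, ⟨_, rfl⟩ | ⟨_, rfl⟩, K⟩ := K); all_goals try (exfalso; omega))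
  all_goals (change _ = _ at H; change _ = _ at K; omega)

lemma compC (m a b d : ℕ) (ha : 1 ≤ a ∧ a < m) (hb : 1 ≤ b ∧ b < m) (hd : 1 ≤ d ∧ d < m) :
    Cp m (W [a, b, m, d]) := by
  by_cases h : a = 1 ∨ b = 1 ∨ m = 1 ∨ d = 1 ∨ a = b ∨ b = m ∨ m = d
  · exact comp_drop m _ _ _ _ (by unfold Lt1; omega) h
  by_cases hx : exC m a b d
  swap
  · refine .inl ⟨_, _, _, _, .inr (.inr (.inl ?_)), rfl⟩
    simp only [TC, Rg, Df, hx, true_and, not_false_eq_true, and_true]; omega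
  unfold exC at hx
  rcases hx with hx | hx | hx | hx
  refine cong ?_ (compB m (b) (d) (a) (by omega) (by omega) (by omega))
  rotate_left
  refine cong ?_ (compB m (d) (b) (m - 1) (by omega) (by omega) (by omega))
  rotate_left
  refine cong ?_ (compB m (2) (m - 1) (2) (by omega) (by omega) (by omega))
  rotate_left
  refine cong ?_ (compB m (m - 1) (2) (3) (by omega) (by omega) (by omega))
  rotate_left
  all_goals (apply W_ext; intro t v w ht H K)
  iterate 4 (all_goals (obtain ⟨_, ⟨_, rfl⟩ | ⟨_, rfl⟩, H⟩ := H); all_goals try (exfalso; omega))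
  iterate 4 (all_goals (obtain ⟨_, ⟨_, rfl⟩ | ⟨_, rfl⟩, K⟩ := K); all_goals try (exfalso; omega))
  all_goals (change _ = _ at H; change _ = _ at K; omega)

lemma compD (m a b c : ℕ) (ha : 1 ≤ a ∧ a < m) (hb : 1 ≤ b ∧ b < m) (hc : 1 ≤ c ∧ c < m) :
    Cp m (W [a, b, c, m]) := by
  by_cases h : a = 1 ∨ b = 1 ∨ c = 1 ∨ m = 1 ∨ a = b ∨ b = c ∨ c = m
  · exact comp_drop m _ _ _ _ (by unfold Lt1; omega) h
  by_cases hx : exD m a b c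
  swap
  · refine .inl ⟨_, _, _, _, .inr (.inr (.inr (.inl ?_))), rfl⟩
    simp only [TD, Rg, Df, hx, true_and, not_false_eq_true, and_true]; omega
  unfold exD at hx
  rcases hx with hx | hx | hx
  refine cong ?_ (compA m (m + b - a) (b) (m + b - a) (by omega) (by omega) (by omega))
  rotate_left
  refine cong ?_ (compA m (c) (m - 1) (a) (by omega) (by omega) (by omega))
  rotate_left
  refine cong ?_ (compA m (m - 1) (2) (m - 1) (by omega) (by omega) (by omega))
  rotate_left
  all_goals (apply W_ext; intro t v w ht H K)
  iterate 4 (all_goals (obtain ⟨_, ⟨_, rfl⟩ | ⟨_, rfl⟩, H⟩ := H); all_goals try (exfalso; omega))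
  iterate 4 (all_goals (obtain ⟨_, ⟨_, rfl⟩ | ⟨_, rfl⟩, K⟩ := K); all_goals try (exfalso; omega))
  all_goals (change _ = _ at H; change _ = _ at K; omega)

lemma compE (m x y : ℕ) (hx : 1 ≤ x ∧ x < m) (hy : 1 ≤ y ∧ y < m) :
    Cp m (W [m, x, m, y]) := by
  by_cases h : m = 1 ∨ x = 1 ∨ m = 1 ∨ y = 1 ∨ m = x ∨ x = m ∨ m = y
  · exact comp_drop m _ _ _ _ (by unfold Lt1; omega) h
  by_cases hx : (x + y = m) ∨ (y + 1 = m) ∨ (x + 1 = m) ∨ (x + y = m + 1)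
  swap
  · refine .inl ⟨_, _, _, _, .inr (.inr (.inr (.inr (.inl ?_)))), rfl⟩
    simp only [TE, Rg, true_and]; omega
  rcases hx with hx | hx | hx | hx
  refine cong ?_ (compB m (y + 1) (x - 1) (m - 1) (by omega) (by omega) (by omega))
  rotate_left
  refine cong ?_ (compC m (m - x) (m - x + 1) (x - 1) (by omega) (by omega) (by omega))
  rotate_left
  refine cong ?_ (compC m (m - y + 1) (m - y) (y - 1) (by omega) (by omega) (by omega))
  rotate_left
  refine cong ?_ (compD m (y - 1) (m - 1) (x - 1) (by omega) (by omega) (by omega))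
  rotate_left
  all_goals (apply W_ext; intro t v w ht H K)
  iterate 4 (all_goals (obtain ⟨_, ⟨_, rfl⟩ | ⟨_, rfl⟩, H⟩ := H); all_goals try (exfalso; omega))
  iterate 4 (all_goals (obtain ⟨_, ⟨_, rfl⟩ | ⟨_, rfl⟩, K⟩ := K); all_goals try (exfalso; omega))
  all_goals (change _ = _ at H; change _ = _ at K; omega)

lemma compF (m x y : ℕ) (hx : 1 ≤ x ∧ x < m) (hy : 1 ≤ y ∧ y < m) :
    Cp m (W [x, m, y, m]) := by
  by_cases h : x = 1 ∨ m = 1 ∨ y = 1 ∨ m = 1 ∨ x = m ∨ m = y ∨ y = m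
  · exact comp_drop m _ _ _ _ (by unfold Lt1; omega) h
  by_cases hx : (x + y ≤ m) ∨ (y + 1 = m) ∨ (x + 1 = m) ∨ (x + y = m + 1)
  swap
  · refine .inl ⟨_, _, _, _, .inr (.inr (.inr (.inr (.inr (.inl ?_))))), rfl⟩
    simp only [TF, Rg, true_and]; omega
  rcases hx with hx | hx | hx | hx
  refine cong ?_ (compE m (y) (x) (by omega) (by omega))
  rotate_left
  refine cong ?_ (compB m (x - 1) (m - x) (m - x + 1) (by omega) (by omega) (by omega))
  rotate_left
  refine cong ?_ (compB m (y - 1) (m - y + 1) (m - y) (by omega) (by omega) (by omega))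
  rotate_left
  refine cong ?_ (compA m (m - x) (m - 1) (x - 1) (by omega) (by omega) (by omega))
  rotate_left
  all_goals (apply W_ext; intro t v w ht H K)
  iterate 4 (all_goals (obtain ⟨_, ⟨_, rfl⟩ | ⟨_, rfl⟩, H⟩ := H); all_goals try (exfalso; omega))
  iterate 4 (all_goals (obtain ⟨_, ⟨_, rfl⟩ | ⟨_, rfl⟩, K⟩ := K); all_goals try (exfalso; omega))
  all_goals (change _ = _ at H; change _ = _ at K; omega)

lemma compG (m x y : ℕ) (hx : 1 ≤ x ∧ x < m) (hy : 1 ≤ y ∧ y < m) :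
    Cp m (W [m, x, y, m]) := by
  by_cases h : m = 1 ∨ x = 1 ∨ y = 1 ∨ m = 1 ∨ m = x ∨ x = y ∨ y = m
  · exact comp_drop m _ _ _ _ (by unfold Lt1; omega) h
  by_cases hx : (x + 1 = m) ∨ (y + 1 = m) ∨ (y = x + 1 ∧ y + 1 < m) ∨ (x = y + 1 ∧ x + 1 < m)
  swap
  · refine .inl ⟨_, _, _, _, .inr (.inr (.inr (.inr (.inr (.inr ?_))))), rfl⟩
    simp only [TG, Rg, true_and]; omega
  rcases hx with hx | hx | hx | hx
  refine cong ?_ (compB m (y + 1) (m - y - 1) (m - y) (by omega) (by omega) (by omega))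
  rotate_left
  refine cong ?_ (compC m (m - x) (m - x - 1) (x + 1) (by omega) (by omega) (by omega))
  rotate_left
  refine cong ?_ (compC m (m - 1 - x) (m - x) (m - 1) (by omega) (by omega) (by omega))
  rotate_left
  refine cong ?_ (compC m (m - x) (m - 1) (m - x + 1) (by omega) (by omega) (by omega))
  rotate_left
  all_goals (apply W_ext; intro t v w ht H K)
  iterate 4 (all_goals (obtain ⟨_, ⟨_, rfl⟩ | ⟨_, rfl⟩, H⟩ := H); all_goals try (exfalso; omega))
  iterate 4 (all_goals (obtain ⟨_, ⟨_, rfl⟩ | ⟨_, rfl⟩, K⟩ := K); all_goals try (exfalso; omega))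
  all_goals (change _ = _ at H; change _ = _ at K; omega)

lemma comp_all (m a b c d : ℕ) (e : Lt1 m a ∧ Lt1 m b ∧ Lt1 m c ∧ Lt1 m d)
    (h : a = m ∨ b = m ∨ c = m ∨ d = m) : Cp m (W [a, b, c, d]) := by
  by_cases hd : a = 1 ∨ b = 1 ∨ c = 1 ∨ d = 1 ∨ a = b ∨ b = c ∨ c = d
  · exact comp_drop m a b c d e hd
  unfold Lt1 at e
  by_cases ha : a = m
  · by_cases hc : c = m
    · subst ha hc; exact compE c b d (by omega) (by omega)
    · by_cases hd : d = m
      · subst ha hd; exact compG d b c (by omega) (by omega)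
      · subst ha; exact compA a b c d (by omega) (by omega) (by omega)
  · by_cases hb : b = m
    · by_cases hd : d = m
      · subst hb hd; exact compF d a c (by omega) (by omega)
      · subst hb; exact compB b a c d (by omega) (by omega) (by omega)
    · by_cases hc : c = m
      · subst hc; exact compC c a b d (by omega) (by omega) (by omega)
      · obtain rfl : d = m := by omega
        exact compD d a b c (by omega) (by omega) (by omega)

lemma comp_le (n a b c d : ℕ) (e : Lt1 n a ∧ Lt1 n b ∧ Lt1 n c ∧ Lt1 n d) :
    ∃ m ≤ n, Cp m (W [a, b, c, d]) := by
  refine ⟨max (max a b) (max c d), by omega, comp_all _ a b c d ?_ (by omega)⟩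
  unfold Lt1; omega

lemma W_one' (a : ℕ) (l : List ℕ) : W (a :: 1 :: l) = W (a :: l) := by
  rw [W_cons, W_one, ← W_cons]

lemma W_one'' (a b : ℕ) (l : List ℕ) : W (a :: b :: 1 :: l) = W (a :: b :: l) := by
  rw [W_cons, W_one', ← W_cons]

lemma W_dup' (b a : ℕ) (l : List ℕ) : W (b :: a :: a :: l) = W (b :: l) := by
  rw [W_cons, W_dup, ← W_cons]

/-- every word of length three is trivial or equal to a short normal form -/
lemma short_form (p q r : ℕ) (hp : 1 ≤ p) (hq : 1 ≤ q) (hr : 1 ≤ r) :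
    W [p, q, r] = 1 ∨ ∃ m p' q' r', Sht m p' q' r' ∧ W [p, q, r] = W [p', q', r'] := by
  have key : ∀ x, 1 ≤ x → W [x] = 1 ∨ ∃ m p' q' r', Sht m p' q' r' ∧ W [x] = W [p', q', r'] := by
    intro x hx
    rcases Nat.lt_or_ge 1 x with h | h
    · exact .inr ⟨x, x, 1, 1, .inl ⟨rfl, by omega⟩, by rw [W_one', W_one']⟩
    · obtain rfl : x = 1 := by omega
      exact .inl (W_one [])
  rcases eq_or_ne p q with rfl | hpq
  · rw [W_dup]; exact key r hr
  rcases eq_or_ne q r with rfl | hqr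
  · rw [W_dup']; exact key p hp
  rcases eq_or_ne p 1 with rfl | hp1
  · rw [W_one]
    rcases lt_or_gt_of_ne hqr with h | h
    · rcases eq_or_ne q 1 with rfl | hq1
      · rw [W_one]; exact key r hr
      · exact .inr ⟨r, q, r, 1, .inr (.inl ⟨rfl, by omega⟩), by rw [W_one'']⟩
    · exact .inr ⟨q, q, r, 1, .inl ⟨rfl, by omega⟩, by rw [W_one'']⟩
  rcases eq_or_ne q 1 with rfl | hq1
  · rw [W_one']
    rcases lt_trichotomy p r with h | rfl | h
    · exact .inr ⟨r, p, r, 1, .inr (.inl ⟨rfl, by omega⟩), by rw [W_one'']⟩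
    · exact .inl (by rw [W_dup]; rfl)
    · exact .inr ⟨p, p, r, 1, .inl ⟨rfl, by omega⟩, by rw [W_one'']⟩
  refine .inr ⟨max (max p q) r, p, q, r, ?_, rfl⟩
  simp only [Sht, S1, S2, S3, S4, Df]
  omega

lemma nrm_not_three {m a b c d p q r : ℕ} (g : Nrm m a b c d) (hp : 1 ≤ p) (hq : 1 ≤ q)
    (hr : 1 ≤ r) (h : W [p, q, r] = W [a, b, c, d]) : False := by
  rcases short_form p q r hp hq hr with e | ⟨m', p', q', r', g', e⟩
  · exact nrm_moves g (by rw [← h, e]; rfl)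
  · exact not_short g g' (by rw [← h, e])

lemma W_filter (l : List ℕ) (hl : ∀ x ∈ l, 1 ≤ x) : W (l.filter (2 ≤ ·)) = W l := by
  induction l with
  | nil => rfl
  | cons a l ih =>
    have ih' := ih (fun x hx => hl x (by simp [hx]))
    have ha := hl a (by simp)
    rw [List.filter_cons]
    split_ifs with h
    · rw [W_cons, ih', ← W_cons]
    · obtain rfl : a = 1 := by simp at h; omega
      rw [ih', W_one]

/-- distance four means being given by a normal word -/
theorem dist_iff (n : ℕ) (π : Equiv.Perm ℕ) :
    pancakeDistEq n 4 π ↔ ∃ m a b c d, m ≤ n ∧ Nrm m a b c d ∧ W [a, b, c, d] = π := by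
  constructor
  · rintro ⟨⟨l, hl, hn, rfl⟩, hs⟩
    match l, hl with
    | [a, b, c, d], _ =>
      have ha := hn a (by simp)
      have hb := hn b (by simp)
      have hc := hn c (by simp)
      have hd := hn d (by simp)
      obtain ⟨m, hm, hC⟩ := comp_le n a b c d (by unfold Lt1; omega)
      rcases hC with ⟨a', b', c', d', g, e⟩ | ⟨p, q, r, hp, hq, hr, e⟩
      · exact ⟨m, a', b', c', d', hm, g, e⟩
      · exfalso
        refine hs ([p, q, r].filter (2 ≤ ·)).length ?_ ⟨_, rfl, ?_, ?_⟩
        · exact Nat.lt_succ_of_le (List.length_filter_le _ _)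
        · intro i hi
          simp only [List.mem_filter, List.mem_cons, List.not_mem_nil, or_false,
            decide_eq_true_eq] at hi
          omega
        · refine (W_filter [p, q, r] ?_).trans e
          intro x hx
          simp only [List.mem_cons, List.not_mem_nil, or_false] at hx
          omega
  · rintro ⟨m, a, b, c, d, hm, g, rfl⟩
    have e := nrm_letters g
    refine ⟨⟨[a, b, c, d], rfl, ?_, rfl⟩, ?_⟩
    · intro i hi
      simp only [List.mem_cons, List.not_mem_nil, or_false] at hi
      omega
    · rintro k hk ⟨l, rfl, hl, hw⟩
      have hw' : W l = W [a, b, c, d] := hw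
      match l, hk with
      | [], _ => exact nrm_not_three (p := 1) (q := 1) (r := 1) g le_rfl le_rfl le_rfl
                  (by rw [← hw', W_one, W_one, W_one])
      | [p], _ =>
        have hp := (hl p (by simp)).1
        exact nrm_not_three (p := p) (q := 1) (r := 1) g (by omega) le_rfl le_rfl
          (by rw [← hw', W_one', W_one'])
      | [p, q], _ =>
        have hp := (hl p (by simp)).1
        have hq := (hl q (by simp)).1
        exact nrm_not_three (p := p) (q := q) (r := 1) g (by omega) (by omega) le_rfl
          (by rw [← hw', W_one''])
      | [p, q, r], _ =>
        have hp := (hl p (by simp)).1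
        have hq := (hl q (by simp)).1
        have hr := (hl r (by simp)).1
        exact nrm_not_three (p := p) (q := q) (r := r) g (by omega) (by omega) (by omega) hw'

/-- the quadruples with a given property are finite in number, and there are `N` of them -/
def HC (p : ℕ → ℕ → ℕ → ℕ → Prop) (N : ℕ) : Prop :=
  ∃ s : Finset (ℕ × ℕ × ℕ × ℕ), (∀ a b c d, (a, b, c, d) ∈ s ↔ p a b c d) ∧ s.card = N

lemma HC.or {p q : ℕ → ℕ → ℕ → ℕ → Prop} {M N : ℕ} (hp : HC p M) (hq : HC q N)
    (h : ∀ a b c d, p a b c d → q a b c d → False) :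
    HC (fun a b c d => p a b c d ∨ q a b c d) (M + N) := by
  obtain ⟨s, hs, rfl⟩ := hp
  obtain ⟨t, ht, rfl⟩ := hq
  refine ⟨s ∪ t, fun a b c d => by rw [Finset.mem_union, hs, ht], Finset.card_union_of_disjoint ?_⟩
  rw [Finset.disjoint_left]
  rintro ⟨a, b, c, d⟩ h1 h2
  exact h a b c d ((hs _ _ _ _).1 h1) ((ht _ _ _ _).1 h2)

lemma HC.diff {p q : ℕ → ℕ → ℕ → ℕ → Prop} {K M N : ℕ} (hp : HC p K) (hq : HC q N)
    (h : ∀ a b c d, q a b c d → p a b c d) (hK : K = M + N) :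
    HC (fun a b c d => p a b c d ∧ ¬ q a b c d) M := by
  obtain ⟨s, hs, hc⟩ := hp
  obtain ⟨t, ht, rfl⟩ := hq
  refine ⟨s \ t, fun a b c d => by rw [Finset.mem_sdiff, hs, ht], ?_⟩
  rw [Finset.card_sdiff_of_subset, hc, hK, Nat.add_sub_cancel]
  rintro ⟨a, b, c, d⟩ h1
  exact (hs _ _ _ _).2 (h _ _ _ _ ((ht _ _ _ _).1 h1))

lemma HC.congr {p q : ℕ → ℕ → ℕ → ℕ → Prop} {M N : ℕ} (hp : HC p M)
    (h : ∀ a b c d, q a b c d ↔ p a b c d) (hN : N = M) : HC q N := by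
  obtain ⟨s, hs, rfl⟩ := hp
  exact ⟨s, fun a b c d => by rw [hs, h], hN.symm⟩

lemma HC.img {α : Type} (P : Finset α) (f : α → ℕ × ℕ × ℕ × ℕ) {p : ℕ → ℕ → ℕ → ℕ → Prop} {N : ℕ}
    (hN : P.card = N) (hi : ∀ x ∈ P, ∀ y ∈ P, f x = f y → x = y)
    (h : ∀ a b c d, p a b c d ↔ ∃ x ∈ P, f x = (a, b, c, d)) : HC p N := by
  refine ⟨P.image f, fun a b c d => by rw [Finset.mem_image, h], ?_⟩
  rw [Finset.card_image_of_injOn, hN]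
  intro x hx y hy e
  exact hi x hx y hy e

lemma HC.pt (a' b' c' d' : ℕ) : HC (fun a b c d => a = a' ∧ b = b' ∧ c = c' ∧ d = d') 1 :=
  ⟨{(a', b', c', d')}, fun a b c d => by simp, rfl⟩

/-- pairs `i < u < n` -/
def Tri (n : ℕ) : Finset (Σ _ : ℕ, ℕ) := (Finset.range n).sigma (fun u => Finset.range u)

lemma card_Tri (n : ℕ) : (Tri n).card = ∑ i ∈ Finset.range n, i := by
  simp [Tri, Finset.card_sigma]

lemma mem_Tri (n u i : ℕ) : (⟨u, i⟩ : Σ _ : ℕ, ℕ) ∈ Tri n ↔ u < n ∧ i < u := by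
  simp [Tri]

lemma two_T (n : ℕ) : 2 * ((∑ i ∈ Finset.range n, i : ℕ) : ℤ) = n * (n - 1) := by
  induction n with
  | zero => simp
  | succ n ih => rw [Finset.sum_range_succ]; push_cast; push_cast at ih; linarith

/-- a triangle of quadruples -/
lemma HC.tri (n : ℕ) {p : ℕ → ℕ → ℕ → ℕ → Prop} (f1 f2 f3 f4 : ℕ → ℕ → ℕ)
    (hi : ∀ u i v k, u < n → i < u → v < n → k < v → f1 u i = f1 v k → f2 u i = f2 v k →
      f3 u i = f3 v k → f4 u i = f4 v k → u = v ∧ i = k)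
    (h : ∀ a b c d, p a b c d ↔ ∃ u i, u < n ∧ i < u ∧ f1 u i = a ∧ f2 u i = b ∧ f3 u i = c ∧
      f4 u i = d) : HC p (∑ i ∈ Finset.range n, i) := by
  refine HC.img (Tri n) (fun x => (f1 x.1 x.2, f2 x.1 x.2, f3 x.1 x.2, f4 x.1 x.2)) (card_Tri n) ?_ ?_
  · rintro ⟨u, i⟩ hx ⟨v, k⟩ hy e
    rw [mem_Tri] at hx hy
    simp only [Prod.mk.injEq] at e
    obtain ⟨rfl, rfl⟩ := hi u i v k hx.1 hx.2 hy.1 hy.2 e.1 e.2.1 e.2.2.1 e.2.2.2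
    rfl
  · intro a b c d
    rw [h]
    constructor
    · rintro ⟨u, i, h1, h2, rfl, rfl, rfl, rfl⟩
      exact ⟨⟨u, i⟩, (mem_Tri _ _ _).2 ⟨h1, h2⟩, rfl⟩
    · rintro ⟨⟨u, i⟩, hx, e⟩
      rw [mem_Tri] at hx
      simp only [Prod.mk.injEq] at e
      exact ⟨u, i, hx.1, hx.2, e⟩

/-- a box of quadruples -/
lemma HC.box (x y z : ℕ) {p : ℕ → ℕ → ℕ → ℕ → Prop} (f1 f2 f3 f4 : ℕ → ℕ → ℕ → ℕ)
    (hi : ∀ u i e v k g, (u < x ∧ i < y ∧ e < z) → (v < x ∧ k < y ∧ g < z) →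
      (f1 u i e = f1 v k g ∧ f2 u i e = f2 v k g ∧ f3 u i e = f3 v k g ∧ f4 u i e = f4 v k g) →
      u = v ∧ i = k ∧ e = g)
    (h : ∀ a b c d, p a b c d ↔ ∃ u i e, (u < x ∧ i < y ∧ e < z) ∧ f1 u i e = a ∧ f2 u i e = b ∧
      f3 u i e = c ∧ f4 u i e = d) : HC p (x * (y * z)) := by
  refine HC.img (Finset.range x ×ˢ Finset.range y ×ˢ Finset.range z)
    (fun t => (f1 t.1 t.2.1 t.2.2, f2 t.1 t.2.1 t.2.2, f3 t.1 t.2.1 t.2.2, f4 t.1 t.2.1 t.2.2))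
    (by simp) ?_ ?_
  · rintro ⟨u, i, e⟩ hx ⟨v, k, g⟩ hy ee
    simp only [Finset.mem_product, Finset.mem_range] at hx hy
    simp only [Prod.mk.injEq] at ee
    obtain ⟨rfl, rfl, rfl⟩ := hi u i e v k g hx hy ee
    rfl
  · intro a b c d
    rw [h]
    constructor
    · rintro ⟨u, i, e, h1, rfl, rfl, rfl, rfl⟩
      exact ⟨(u, i, e), by simpa using h1, rfl⟩
    · rintro ⟨⟨u, i, e⟩, hx, ee⟩
      simp only [Finset.mem_product, Finset.mem_range] at hx
      simp only [Prod.mk.injEq] at ee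
      exact ⟨u, i, e, hx, ee⟩

/-- the `i`-th number different from `c` -/
def sk (c i : ℕ) : ℕ := if i < c then i else i + 1

lemma sk_spec (c i : ℕ) : (i < c ∧ sk c i = i) ∨ (c ≤ i ∧ sk c i = i + 1) := by
  unfold sk; split_ifs <;> omega

lemma sk_surj (n c b : ℕ) (hc : c < n + 1) (hb : b < n + 1) (h : b < c ∨ c < b) :
    ∃ i < n, sk c i = b := by
  rcases h with h | h
  · exact ⟨b, by omega, by have := sk_spec c b; omega⟩
  · exact ⟨b - 1, by omega, by have := sk_spec c (b - 1); omega⟩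

lemma full_A (j : ℕ) : HC (fun a b c d => a = j + 5 ∧ Rg (j + 5) b ∧ Rg (j + 5) c ∧ Rg (j + 5) d ∧
    Df b c ∧ Df c d) ((j + 3) * ((j + 2) * (j + 2))) := by
  refine HC.box _ _ _ (fun _ _ _ => j + 5) (fun u i _ => sk u i + 2) (fun u _ _ => u + 2)
    (fun u _ e => sk u e + 2) ?_ ?_
  · intro u i e v k g h1 h2 h3
    beta_reduce at h3
    obtain rfl : u = v := by omega
    have := sk_spec u i; have := sk_spec u k; have := sk_spec u e; have := sk_spec u g
    omega
  · intro a b c d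
    simp only [Rg, Df]
    constructor
    · intro h
      obtain ⟨i, hi, hi'⟩ := sk_surj (j + 2) (c - 2) (b - 2) (by omega) (by omega) (by omega)
      obtain ⟨e, he, he'⟩ := sk_surj (j + 2) (c - 2) (d - 2) (by omega) (by omega) (by omega)
      exact ⟨c - 2, i, e, by omega, by omega, by omega, by omega, by omega⟩
    · rintro ⟨u, i, e, h, rfl, rfl, rfl, rfl⟩
      have := sk_spec u i; have := sk_spec u e
      omega

lemma full_D (j : ℕ) : HC (fun a b c d => d = j + 5 ∧ Rg (j + 5) a ∧ Rg (j + 5) b ∧ Rg (j + 5) c ∧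
    Df a b ∧ Df b c) ((j + 3) * ((j + 2) * (j + 2))) := by
  obtain ⟨s, hs, hc⟩ := full_A j
  refine HC.img s (fun x => (x.2.1, x.2.2.1, x.2.2.2, x.1)) hc ?_ ?_
  · rintro ⟨a, b, c, d⟩ - ⟨a', b', c', d'⟩ - e
    simp only [Prod.mk.injEq] at e ⊢
    omega
  · intro a b c d
    constructor
    · intro h; exact ⟨(d, a, b, c), (hs _ _ _ _).2 h, rfl⟩
    · rintro ⟨⟨a', b', c', d'⟩, hx, e⟩
      simp only [Prod.mk.injEq] at e
      obtain ⟨rfl, rfl, rfl, rfl⟩ := e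
      exact (hs _ _ _ _).1 hx

lemma full_B (j : ℕ) : HC (fun a b c d => b = j + 5 ∧ Rg (j + 5) a ∧ Rg (j + 5) c ∧ Rg (j + 5) d ∧
    Df c d) ((j + 3) * ((j + 3) * (j + 2))) := by
  refine HC.box _ _ _ (fun _ i _ => i + 2) (fun _ _ _ => j + 5) (fun u _ _ => u + 2)
    (fun u _ e => sk u e + 2) ?_ ?_
  · intro u i e v k g h1 h2 h3
    beta_reduce at h3
    obtain rfl : u = v := by omega
    have := sk_spec u e; have := sk_spec u g
    omega
  · intro a b c d
    simp only [Rg, Df]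
    constructor
    · intro h
      obtain ⟨e, he, he'⟩ := sk_surj (j + 2) (c - 2) (d - 2) (by omega) (by omega) (by omega)
      exact ⟨c - 2, a - 2, e, by omega, by omega, by omega, by omega, by omega⟩
    · rintro ⟨u, i, e, h, rfl, rfl, rfl, rfl⟩
      have := sk_spec u e
      omega

lemma full_C (j : ℕ) : HC (fun a b c d => c = j + 5 ∧ Rg (j + 5) a ∧ Rg (j + 5) b ∧ Rg (j + 5) d ∧
    Df a b) ((j + 3) * ((j + 3) * (j + 2))) := by
  obtain ⟨s, hs, hc⟩ := full_B j
  refine HC.img s (fun x => (x.2.2.1, x.2.2.2, x.2.1, x.1)) hc ?_ ?_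
  · rintro ⟨a, b, c, d⟩ - ⟨a', b', c', d'⟩ - e
    simp only [Prod.mk.injEq] at e ⊢
    omega
  · intro a b c d
    constructor
    · rintro ⟨h1, h2, h3, h4, h5⟩; exact ⟨(d, c, a, b), (hs _ _ _ _).2 ⟨h1, h4, h2, h3, h5⟩, rfl⟩
    · rintro ⟨⟨a', b', c', d'⟩, hx, e⟩
      simp only [Prod.mk.injEq] at e
      obtain ⟨rfl, rfl, rfl, rfl⟩ := e
      obtain ⟨h1, h4, h2, h3, h5⟩ := (hs _ _ _ _).1 hx
      exact ⟨h1, h2, h3, h4, h5⟩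

lemma cnt_A (j N : ℕ) (hN : (j + 3) * ((j + 2) * (j + 2)) = N + 1) : HC (TA (j + 5)) N := by
  refine ((full_A j).diff (HC.pt (j + 5) 3 2 3) ?_ hN).congr ?_ rfl
  · simp only [Rg, Df]; omega
  · intro a b c d
    simp only [TA, exA]
    tauto

lemma cnt_B (j N : ℕ) (hN : (j + 3) * ((j + 3) * (j + 2)) = N + 2) : HC (TB (j + 5)) N := by
  refine ((full_B j).diff ((HC.pt (j + 4) (j + 5) (j + 4) (j + 3)).or
    (HC.pt 2 (j + 5) (j + 3) (j + 4)) ?_) ?_ hN).congr ?_ rfl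
  · omega
  · simp only [Rg, Df]; omega
  · intro a b c d
    simp only [TB, exB, Rg, Df]
    omega

lemma cnt_C (j N : ℕ) (hN : (j + 3) * ((j + 3) * (j + 2)) =
    N + ((∑ i ∈ Finset.range (j + 3), i) + (j + 2) + 1 + 1)) : HC (TC (j + 5)) N := by
  refine ((full_C j).diff ((((HC.tri (j + 3) (p := fun a b c d => 2 ≤ a ∧ a < d ∧ d < j + 5 ∧
      c = j + 5 ∧ b + d = j + 5 + a) (fun _ i => i + 2) (fun u i => j + 5 + i - u)
    (fun _ _ => j + 5) (fun u _ => u + 2) ?_ ?_).or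
    (HC.img (p := fun a b c d => a = j + 4 ∧ c = j + 5 ∧ 2 ≤ b ∧ 2 ≤ d ∧ b + d = j + 5)
      (N := j + 2) (Finset.range (j + 2)) (fun i => (j + 4, i + 2, j + 5, j + 3 - i)) ?_ ?_ ?_)
      ?_).or (HC.pt 3 2 (j + 5) (j + 4)) ?_).or (HC.pt 2 (j + 4) (j + 5) 2) ?_) ?_ hN).congr ?_ rfl
  · intro u i v k; beta_reduce; omega
  · intro a b c d
    constructor
    · intro h; exact ⟨d - 2, a - 2, by omega⟩
    · rintro ⟨u, i, h⟩; omega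
  · simp
  · intro x hx y hy e
    simp only [Prod.mk.injEq] at e
    omega
  · intro a b c d
    simp only [Finset.mem_range, Prod.mk.injEq]
    constructor
    · intro h; exact ⟨b - 2, by omega⟩
    · rintro ⟨u, h⟩; omega
  · omega
  · omega
  · omega
  · simp only [Rg, Df]; omega
  · intro a b c d
    simp only [TC, exC, Rg, Df]
    omega

lemma cnt_D (j N : ℕ) (hN : (j + 3) * ((j + 2) * (j + 2)) =
    N + ((∑ i ∈ Finset.range (j + 3), i) + (j + 2) + 1)) : HC (TD (j + 5)) N := by
  refine ((full_D j).diff (((HC.tri (j + 3) (p := fun a b c d => 2 ≤ b ∧ b < a ∧ a < j + 5 ∧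
      d = j + 5 ∧ c = a) (fun u _ => u + 2) (fun _ i => i + 2)
    (fun u _ => u + 2) (fun _ _ => j + 5) ?_ ?_).or
    (HC.img (p := fun a b c d => b = j + 4 ∧ d = j + 5 ∧ 2 ≤ a ∧ 2 ≤ c ∧ a + c = j + 5)
      (N := j + 2) (Finset.range (j + 2)) (fun i => (i + 2, j + 4, j + 3 - i, j + 5)) ?_ ?_ ?_)
      ?_).or (HC.pt 2 3 2 (j + 5)) ?_) ?_ hN).congr ?_ rfl
  · intro u i v k; beta_reduce; omega
  · intro a b c d
    constructor
    · intro h; exact ⟨a - 2, b - 2, by omega⟩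
    · rintro ⟨u, i, h⟩; omega
  · simp
  · intro x hx y hy e
    simp only [Prod.mk.injEq] at e
    omega
  · intro a b c d
    simp only [Finset.mem_range, Prod.mk.injEq]
    constructor
    · intro h; exact ⟨a - 2, by omega⟩
    · rintro ⟨u, h⟩; omega
  · omega
  · omega
  · simp only [Rg, Df]; omega
  · intro a b c d
    simp only [TD, exD, Rg, Df]
    omega

lemma cnt_E (j N : ℕ) (hN : 1 * ((j + 2) * (j + 2)) = N + ((j + 2) + (j + 1))) :
    HC (TE (j + 5)) N := by
  refine ((HC.box 1 (j + 2) (j + 2) (p := fun a b c d => a = j + 5 ∧ c = j + 5 ∧ 2 ≤ b ∧ b < j + 4 ∧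
    2 ≤ d ∧ d < j + 4) (fun _ _ _ => j + 5) (fun _ i _ => i + 2) (fun _ _ _ => j + 5)
    (fun _ _ e => e + 2) ?_ ?_).diff
    ((HC.img (p := fun a b c d => a = j + 5 ∧ c = j + 5 ∧ 2 ≤ b ∧ 2 ≤ d ∧ b + d = j + 5)
      (N := j + 2) (Finset.range (j + 2)) (fun i => (j + 5, i + 2, j + 5, j + 3 - i)) ?_ ?_ ?_).or
     (HC.img (p := fun a b c d => a = j + 5 ∧ c = j + 5 ∧ 3 ≤ b ∧ 3 ≤ d ∧ b + d = j + 6)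
      (N := j + 1) (Finset.range (j + 1)) (fun i => (j + 5, i + 3, j + 5, j + 3 - i)) ?_ ?_ ?_)
      ?_) ?_ hN).congr ?_ rfl
  · intro u i e v k g h1 h2; beta_reduce; omega
  · intro a b c d
    constructor
    · intro h; exact ⟨0, b - 2, d - 2, by omega⟩
    · rintro ⟨u, i, e, h⟩; omega
  · simp
  · intro x hx y hy e
    simp only [Prod.mk.injEq] at e
    omega
  · intro a b c d
    simp only [Finset.mem_range, Prod.mk.injEq]
    constructor
    · intro h; exact ⟨b - 2, by omega⟩
    · rintro ⟨u, h⟩; omega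
  · simp
  · intro x hx y hy e
    simp only [Prod.mk.injEq] at e
    omega
  · intro a b c d
    simp only [Finset.mem_range, Prod.mk.injEq]
    constructor
    · intro h; exact ⟨b - 3, by omega⟩
    · rintro ⟨u, h⟩; omega
  · omega
  · omega
  · intro a b c d
    simp only [TE, Rg]
    omega

lemma cnt_F (j : ℕ) : HC (TF (j + 5)) (∑ i ∈ Finset.range (j + 1), i) := by
  refine HC.tri (j + 1) (fun u i => j + 3 - i) (fun _ _ => j + 5) (fun u i => j + 4 + i - u)
    (fun _ _ => j + 5) ?_ ?_
  · intro u i v k; beta_reduce; omega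
  · intro a b c d
    simp only [TF, Rg]
    constructor
    · intro h; exact ⟨2 * j + 7 - a - c, j + 3 - a, by omega⟩
    · rintro ⟨u, i, h⟩; omega

lemma cnt_G (j : ℕ) : HC (TG (j + 5))
    ((∑ i ∈ Finset.range (j + 1), i) + (∑ i ∈ Finset.range (j + 1), i)) := by
  refine ((HC.tri (j + 1) (p := fun a b c d => a = j + 5 ∧ d = j + 5 ∧ 2 ≤ b ∧ b + 1 < c ∧
    c < j + 4) (fun _ _ => j + 5) (fun _ i => i + 2) (fun u _ => u + 3) (fun _ _ => j + 5) ?_ ?_).or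
    (HC.tri (j + 1) (p := fun a b c d => a = j + 5 ∧ d = j + 5 ∧ 2 ≤ c ∧ c + 1 < b ∧
    b < j + 4) (fun _ _ => j + 5) (fun u _ => u + 3) (fun _ i => i + 2) (fun _ _ => j + 5) ?_ ?_)
    ?_).congr ?_ rfl
  · intro u i v k; beta_reduce; omega
  · intro a b c d
    constructor
    · intro h; exact ⟨c - 3, b - 2, by omega⟩
    · rintro ⟨u, i, h⟩; omega
  · intro u i v k; beta_reduce; omega
  · intro a b c d
    constructor
    · intro h; exact ⟨b - 3, c - 2, by omega⟩
    · rintro ⟨u, i, h⟩; omega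
  · omega
  · intro a b c d
    simp only [TG, Rg]
    omega

/-- the number of normal words with a given top letter -/
lemma cnt_Nrm (j : ℕ) : ∃ N : ℕ, HC (Nrm (j + 5)) N ∧
    2 * (N : ℤ) = 8 * (j + 5) ^ 3 - 57 * (j + 5) ^ 2 + 111 * (j + 5) - 40 := by
  have t1 := two_T (j + 3)
  have t2 := two_T (j + 1)
  obtain ⟨S, hS⟩ : ∃ S, S = ∑ i ∈ Finset.range (j + 3), i := ⟨_, rfl⟩
  obtain ⟨T, hT⟩ : ∃ T, T = ∑ i ∈ Finset.range (j + 1), i := ⟨_, rfl⟩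
  rw [← hS] at t1
  rw [← hT] at t2
  push_cast at t1 t2
  have t1' : 2 * S = (j + 3) * (j + 2) := by zify; linarith
  obtain ⟨A, hA⟩ : ∃ N, (j + 3) * ((j + 2) * (j + 2)) = N + 1 :=
    Nat.exists_eq_add_of_le' (by nlinarith)
  obtain ⟨B, hB⟩ : ∃ N, (j + 3) * ((j + 3) * (j + 2)) = N + 2 :=
    Nat.exists_eq_add_of_le' (by nlinarith)
  obtain ⟨C, hC⟩ : ∃ N, (j + 3) * ((j + 3) * (j + 2)) = N + (S + (j + 2) + 1 + 1) :=
    Nat.exists_eq_add_of_le' (by nlinarith [Nat.zero_le (j ^ 3), Nat.zero_le (j ^ 2)])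
  obtain ⟨D, hD⟩ : ∃ N, (j + 3) * ((j + 2) * (j + 2)) = N + (S + (j + 2) + 1) :=
    Nat.exists_eq_add_of_le' (by nlinarith [Nat.zero_le (j ^ 3), Nat.zero_le (j ^ 2)])
  obtain ⟨E, hE⟩ : ∃ N, 1 * ((j + 2) * (j + 2)) = N + ((j + 2) + (j + 1)) :=
    Nat.exists_eq_add_of_le' (by nlinarith)
  have cA := cnt_A j A hA
  have cB := cnt_B j B hB
  have cC := cnt_C j C (hS ▸ hC)
  have cD := cnt_D j D (hS ▸ hD)
  have cE := cnt_E j E hE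
  have cF := cnt_F j
  have cG := cnt_G j
  rw [← hT] at cF cG
  refine ⟨_, (cA.or (cB.or (cC.or (cD.or (cE.or (cF.or cG ?_) ?_) ?_) ?_) ?_) ?_).congr
    (fun _ _ _ _ => Iff.rfl) rfl, ?_⟩
  iterate 6 (rotate_left; intro a b c d; simp only [TA, TB, TC, TD, TE, TF, TG, Rg]; omega)
  zify at hA hB hC hD hE
  push_cast
  linarith

lemma nrm_top {m a b c d : ℕ} (g : Nrm m a b c d) : a = m ∨ b = m ∨ c = m ∨ d = m := by
  simp only [Nrm, TA, TB, TC, TD, TE, TF, TG] at g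
  omega

lemma cnt_four : HC (fun a b c d => ∃ m ≤ 4, Nrm m a b c d) 3 := by
  refine (((HC.pt 4 2 3 2).or (HC.pt 2 4 3 2) (by omega)).or (HC.pt 3 4 2 3) (by omega)).congr ?_ rfl
  intro a b c d
  constructor
  · rintro ⟨m, hm, g⟩
    have e := nrm_letters g
    have hm' : 2 ≤ m := e.1.1.trans e.1.2
    interval_cases m <;> rcases g with g | g | g | g | g | g | g <;>
      simp only [TA, TB, TC, TD, TE, TF, TG, Rg, Df, exA, exB, exC, exD] at g <;> omega
  · intro h
    refine ⟨4, le_rfl, ?_⟩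
    rcases h with (⟨rfl, rfl, rfl, rfl⟩ | ⟨rfl, rfl, rfl, rfl⟩) | ⟨rfl, rfl, rfl, rfl⟩
    · left; norm_num [TA, Rg, Df, exA]
    · right; left; norm_num [TB, Rg, Df, exB]
    · right; left; norm_num [TB, Rg, Df, exB]

/-- the number of normal words with letters up to `n` -/
theorem cnt_all (j : ℕ) : ∃ N : ℕ, HC (fun a b c d => ∃ m ≤ j + 4, Nrm m a b c d) N ∧
    2 * (N : ℤ) = 2 * (j + 4) ^ 4 - 15 * (j + 4) ^ 3 + 29 * (j + 4) ^ 2 + 6 * (j + 4) - 34 := by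
  induction j with
  | zero => exact ⟨3, cnt_four, by norm_num⟩
  | succ j ih =>
    obtain ⟨N, hN, eN⟩ := ih
    obtain ⟨M, hM, eM⟩ := cnt_Nrm j
    refine ⟨_, (hN.or hM ?_).congr ?_ rfl, ?_⟩
    · rintro a b c d ⟨m, hm, g⟩ g'
      have := nrm_letters g
      have := nrm_top g'
      omega
    · intro a b c d
      constructor
      · rintro ⟨m, hm, g⟩
        rcases Nat.lt_or_ge m (j + 5) with h | h
        · exact .inl ⟨m, by omega, g⟩
        · obtain rfl : m = j + 5 := by omega
          exact .inr g
      · rintro (⟨m, hm, g⟩ | g)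
        · exact ⟨m, by omega, g⟩
        · exact ⟨j + 5, by omega, g⟩
    · push_cast
      linarith

end Pancake

open Pancake

/-- For `n ≥ 4`, the number of permutations in `S_n` at pancake distance exactly `4`
from the identity is `(2n⁴ - 15n³ + 29n² + 6n - 34)/2`. -/
theorem count_distance_four (n : ℕ) (hn : 4 ≤ n) :
    2 * (Nat.card {π : Equiv.Perm ℕ // pancakeDistEq n 4 π} : ℤ)
      = 2 * (n : ℤ) ^ 4 - 15 * (n : ℤ) ^ 3 + 29 * (n : ℤ) ^ 2 + 6 * (n : ℤ) - 34 := by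
  obtain ⟨j, rfl⟩ := Nat.exists_eq_add_of_le' hn
  obtain ⟨N, ⟨s, hs, rfl⟩, e⟩ := cnt_all j
  have hset : {π : Equiv.Perm ℕ | pancakeDistEq (j + 4) 4 π} =
      (fun x : ℕ × ℕ × ℕ × ℕ => W [x.1, x.2.1, x.2.2.1, x.2.2.2]) '' (s : Set (ℕ × ℕ × ℕ × ℕ)) := by
    ext π
    rw [Set.mem_ofPred_eq, dist_iff]
    constructor
    · rintro ⟨m, a, b, c, d, hm, g, h⟩
      exact ⟨(a, b, c, d), (hs _ _ _ _).2 ⟨m, hm, g⟩, h⟩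
    · rintro ⟨⟨a, b, c, d⟩, hx, h⟩
      obtain ⟨m, hm, g⟩ := (hs _ _ _ _).1 hx
      exact ⟨m, a, b, c, d, hm, g, h⟩
  have hcard : Nat.card {π : Equiv.Perm ℕ // pancakeDistEq (j + 4) 4 π} = s.card := by
    have h1 : Nat.card {π : Equiv.Perm ℕ // pancakeDistEq (j + 4) 4 π} =
        {π : Equiv.Perm ℕ | pancakeDistEq (j + 4) 4 π}.ncard := rfl
    rw [h1, hset, Set.InjOn.ncard_image, Set.ncard_coe_finset]
    rintro ⟨a, b, c, d⟩ hx ⟨a', b', c', d'⟩ hy h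
    obtain ⟨m, hm, g⟩ := (hs _ _ _ _).1 hx
    obtain ⟨m', hm', g'⟩ := (hs _ _ _ _).1 hy
    obtain ⟨rfl, rfl, rfl, rfl⟩ := uniq g g' h
    rfl
  rw [hcard, e]
  push_cast
  ring
end

section
/- For n ≥ 1, the number of signed permutations in B_n at burnt-pancake distance exactly 1 from the identity is n, at distance exactly 2 is n(n−1), and at distance exactly 3 is n(n−1)². -/
/-- The signed prefix reversal `r_i^B` as a function on `ℤ`: it sends `j` to `-(i+1-j)`
for `1 ≤ j ≤ i`, respects `f (-j) = - f j`, and fixes everything with `|j| > i`. -/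
def burntFun (i : ℤ) : ℤ → ℤ := fun j =>
  if 1 ≤ j ∧ j ≤ i then j - (i + 1) else if -i ≤ j ∧ j ≤ -1 then j + (i + 1) else j

lemma burntFun_invol (i : ℤ) : Function.Involutive (burntFun i) := by
  intro j; unfold burntFun; split_ifs <;> omega

/-- The burnt pancake flip (signed prefix reversal) `r_i^B`, as a permutation of `ℤ`. -/
def burntFlip (i : ℕ) : Equiv.Perm ℤ := Function.Involutive.toPerm _ (burntFun_invol i)


/-- `π` is a product of `k` burnt pancake flips `r_i^B` with `1 ≤ i ≤ n`. -/
def burntWord (n k : ℕ) (π : Equiv.Perm ℤ) : Prop :=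
  ∃ l : List ℕ, l.length = k ∧ (∀ i ∈ l, 1 ≤ i ∧ i ≤ n) ∧ (l.map burntFlip).prod = π

/-- The burnt pancake distance from the identity to `π` (in `B_n`) is exactly `k`. -/
def burntDistEq (n k : ℕ) (π : Equiv.Perm ℤ) : Prop :=
  burntWord n k π ∧ ∀ m < k, ¬ burntWord n m π


namespace BurntAux

local notation "s" => burntFlip

lemma s_apply (i : ℕ) (x : ℤ) : s i x =
    if 1 ≤ x ∧ x ≤ i then x - (i + 1) else if -i ≤ x ∧ x ≤ -1 then x + (i + 1) else x := rfl

lemma s_fix {i m : ℕ} (h : i < m) : s i (m : ℤ) = m := by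
  rw [s_apply]; split_ifs <;> omega

lemma s_mid {i j : ℕ} (h : 1 ≤ j) (h' : j ≤ i) : s i (j : ℤ) = j - (i + 1) := by
  rw [s_apply]; split_ifs <;> omega

lemma s_top {i : ℕ} (h : 1 ≤ i) : s i (i : ℤ) = -1 := by
  rw [s_apply]; split_ifs <;> omega

lemma s_neg_one {i : ℕ} (h : 1 ≤ i) : s i (-1) = i := by
  rw [s_apply]; split_ifs <;> omega

lemma s_eq_neg_one {i : ℕ} {x : ℤ} (h : 1 ≤ i) (hx : s i x = -1) : x = i := by
  rw [s_apply] at hx; split_ifs at hx <;> omega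

lemma s_eq_top {i : ℕ} {x : ℤ} (h : 1 ≤ i) (hx : s i x = i) : x = -1 := by
  rw [s_apply] at hx; split_ifs at hx <;> omega

lemma s_sq (i : ℕ) : s i * s i = 1 := by
  ext x; exact burntFun_invol i x

lemma s_sq_mul (i : ℕ) (p : Equiv.Perm ℤ) : s i * (s i * p) = p := by
  rw [← mul_assoc, s_sq, one_mul]

lemma s_inj {i j : ℕ} (hi : 1 ≤ i) (hj : 1 ≤ j) (h : s i = s j) : i = j := by
  have h1 := s_neg_one hi
  rw [h, s_neg_one hj] at h1
  omega

lemma conj_one {i : ℕ} {p : Equiv.Perm ℤ} (h : s i * (p * s i) = 1) : p = 1 := by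
  have h2 := mul_eq_one_comm.1 h
  rwa [mul_assoc, s_sq, mul_one] at h2

/-! Relations whose first letter is maximal. -/

lemma M1 {a : ℕ} (ha : 1 ≤ a) : s a ≠ 1 := by
  intro h
  have := s_top ha
  rw [h, Equiv.Perm.one_apply] at this
  omega

lemma M3 {a b c : ℕ} (ha : 1 ≤ a) (hb : b < a) (hc : c < a) : s a * (s b * s c) ≠ 1 := by
  intro h
  have h1 := congrArg (fun p : Equiv.Perm ℤ => p a) h
  simp only [Equiv.Perm.mul_apply, Equiv.Perm.one_apply, s_fix, hb, hc, s_top ha] at h1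
  omega

lemma M4 {a b c d : ℕ} (ha : 1 ≤ a) (hb : 1 ≤ b) (hab : b < a) (hac : c ≤ a) (hd : d < a) :
    s a * (s b * (s c * s d)) ≠ 1 := by
  intro h
  have h1 := congrArg (fun p : Equiv.Perm ℤ => p a) h
  rcases hac.lt_or_eq with hc | rfl
  · simp only [Equiv.Perm.mul_apply, Equiv.Perm.one_apply, s_fix, hab, hc, hd, s_top ha] at h1
    omega
  · simp only [Equiv.Perm.mul_apply, Equiv.Perm.one_apply, s_fix hd, s_top ha,
      s_neg_one hb, s_mid hb hab.le] at h1
    omega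

lemma M5 {a b c d e : ℕ} (ha : 1 ≤ a) (hb : 1 ≤ b) (hc0 : 1 ≤ c)
    (hab : b < a) (hac : c ≤ a) (had : d ≤ a) (he : e < a) (hbc : b ≠ c) (hcd : c ≠ d) :
    s a * (s b * (s c * (s d * s e))) ≠ 1 := by
  intro h
  have h1 := congrArg (fun p : Equiv.Perm ℤ => p a) h
  rcases hac.lt_or_eq with hc | rfl
  · rcases had.lt_or_eq with hd | rfl
    · simp only [Equiv.Perm.mul_apply, Equiv.Perm.one_apply, s_fix, hab, hc, hd, he, s_top ha] at h1
      omega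
    · simp only [Equiv.Perm.mul_apply, Equiv.Perm.one_apply, s_fix he, s_top ha,
        s_neg_one hc0] at h1
      have h2 := s_eq_neg_one hb (s_eq_top ha h1)
      omega
  · have hd : d < c := by omega
    simp only [Equiv.Perm.mul_apply, Equiv.Perm.one_apply, s_fix he, s_fix hd, s_top ha,
      s_neg_one hb, s_mid hb hab.le] at h1
    omega

lemma M6 {a b c d e f : ℕ} (ha : 1 ≤ a) (hb : 1 ≤ b) (hc0 : 1 ≤ c) (hd0 : 1 ≤ d) (hf0 : 1 ≤ f)
    (hab : b < a) (hac : c ≤ a) (had : d ≤ a) (hae : e ≤ a) (hf : f < a)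
    (hbc : b ≠ c) (hcd : c ≠ d) (hde : d ≠ e) :
    s a * (s b * (s c * (s d * (s e * s f)))) ≠ 1 := by
  intro h
  have h1 := congrArg (fun p : Equiv.Perm ℤ => p a) h
  have h3 := congrArg (fun p : Equiv.Perm ℤ => p f) h
  simp only [Equiv.Perm.mul_apply, Equiv.Perm.one_apply, s_fix hf, s_top hf0] at h1 h3
  rcases hac.lt_or_eq with hc | rfl
  · rcases had.lt_or_eq with hd | rfl
    · rcases hae.lt_or_eq with he | rfl
      · simp only [s_fix, hab, hc, hd, he, s_top ha] at h1
        omega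
      · simp only [s_fix, hab, hc, hd, s_top ha, s_neg_one ha] at h3
        omega
    · have he : e < d := by omega
      simp only [s_fix he, s_top ha, s_neg_one hc0] at h1
      have h2 := s_eq_neg_one hb (s_eq_top ha h1)
      omega
  · have hd : d < c := by omega
    rcases hae.lt_or_eq with he | rfl
    · simp only [s_fix he, s_fix hd, s_top ha, s_neg_one hb, s_mid hb hab.le] at h1
      omega
    · simp only [s_top ha, s_neg_one hd0, s_mid hd0 hd.le] at h1
      have h2 := s_eq_top ha h1
      rw [s_apply] at h2
      split_ifs at h2 <;> omega

/-! Relations given by reduced words. -/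

lemma R2 {a b : ℕ} (ha : 1 ≤ a) (hb : 1 ≤ b) (hab : a ≠ b) : s a * s b ≠ 1 := by
  intro h
  apply hab
  apply s_inj ha hb
  have := congrArg (fun p => p * s b) h
  simpa [mul_assoc, s_sq] using this

lemma rot {p q : Equiv.Perm ℤ} (h : p * q = 1) : q * p = 1 := mul_eq_one_comm.1 h

lemma R3 {a b c : ℕ} (ha : 1 ≤ a) (hb : 1 ≤ b) (hc : 1 ≤ c) (hab : a ≠ b) (hbc : b ≠ c) :
    s a * (s b * s c) ≠ 1 := by
  intro h
  by_cases hca : c = a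
  · subst hca
    exact M1 hb (conj_one h)
  have r1 := rot h
  have r2 := rot (by simpa only [mul_assoc] using r1 : s b * (s c * s a) = 1)
  simp only [mul_assoc] at r1 r2
  rcases (by omega : (b < a ∧ c < a) ∨ (c < b ∧ a < b) ∨ (a < c ∧ b < c)) with
    ⟨h1, h2⟩ | ⟨h1, h2⟩ | ⟨h1, h2⟩
  · exact M3 ha h1 h2 h
  · exact M3 hb h1 h2 r1
  · exact M3 hc h1 h2 r2

lemma R4 {a b c d : ℕ} (ha : 1 ≤ a) (hb : 1 ≤ b) (hc : 1 ≤ c) (hd : 1 ≤ d)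
    (hab : a ≠ b) (hbc : b ≠ c) (hcd : c ≠ d) :
    s a * (s b * (s c * s d)) ≠ 1 := by
  intro h
  by_cases hda : d = a
  · subst hda
    exact R2 hb hc hbc (conj_one (by simpa only [mul_assoc] using h))
  have r1 := rot h
  simp only [mul_assoc] at r1
  have r2 := rot r1
  simp only [mul_assoc] at r2
  have r3 := rot r2
  simp only [mul_assoc] at r3
  rcases (by omega : (b ≤ a ∧ c ≤ a ∧ d ≤ a) ∨ (a ≤ b ∧ c ≤ b ∧ d ≤ b) ∨
    (a ≤ c ∧ b ≤ c ∧ d ≤ c) ∨ (a ≤ d ∧ b ≤ d ∧ c ≤ d)) with hm | hm | hm | hm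
  · exact M4 ha hb (by omega) (by omega) (by omega) h
  · exact M4 hb hc (by omega) (by omega) (by omega) r1
  · exact M4 hc hd (by omega) (by omega) (by omega) r2
  · exact M4 hd ha (by omega) (by omega) (by omega) r3

lemma R5 {a b c d e : ℕ} (ha : 1 ≤ a) (hb : 1 ≤ b) (hc : 1 ≤ c) (hd : 1 ≤ d) (he : 1 ≤ e)
    (hab : a ≠ b) (hbc : b ≠ c) (hcd : c ≠ d) (hde : d ≠ e) :
    s a * (s b * (s c * (s d * s e))) ≠ 1 := by
  intro h
  by_cases hea : e = a
  · subst hea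
    exact R3 hb hc hd hbc hcd (conj_one (by simpa only [mul_assoc] using h))
  have r1 := rot h
  simp only [mul_assoc] at r1
  have r2 := rot r1
  simp only [mul_assoc] at r2
  have r3 := rot r2
  simp only [mul_assoc] at r3
  have r4 := rot r3
  simp only [mul_assoc] at r4
  rcases (by omega : (b ≤ a ∧ c ≤ a ∧ d ≤ a ∧ e ≤ a) ∨ (a ≤ b ∧ c ≤ b ∧ d ≤ b ∧ e ≤ b) ∨
    (a ≤ c ∧ b ≤ c ∧ d ≤ c ∧ e ≤ c) ∨ (a ≤ d ∧ b ≤ d ∧ c ≤ d ∧ e ≤ d) ∨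
    (a ≤ e ∧ b ≤ e ∧ c ≤ e ∧ d ≤ e)) with hm | hm | hm | hm | hm
  · exact M5 ha hb hc (by omega) (by omega) (by omega) (by omega) (by omega) (by omega) h
  · exact M5 hb hc hd (by omega) (by omega) (by omega) (by omega) (by omega) (by omega) r1
  · exact M5 hc hd he (by omega) (by omega) (by omega) (by omega) (by omega) (by omega) r2
  · exact M5 hd he ha (by omega) (by omega) (by omega) (by omega) (by omega) (by omega) r3
  · exact M5 he ha hb (by omega) (by omega) (by omega) (by omega) (by omega) (by omega) r4

lemma R6 {a b c d e f : ℕ} (ha : 1 ≤ a) (hb : 1 ≤ b) (hc : 1 ≤ c) (hd : 1 ≤ d) (he : 1 ≤ e)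
    (hf : 1 ≤ f) (hab : a ≠ b) (hbc : b ≠ c) (hcd : c ≠ d) (hde : d ≠ e) (hef : e ≠ f) :
    s a * (s b * (s c * (s d * (s e * s f)))) ≠ 1 := by
  intro h
  by_cases hfa : f = a
  · subst hfa
    exact R4 hb hc hd he hbc hcd hde (conj_one (by simpa only [mul_assoc] using h))
  have r1 := rot h
  simp only [mul_assoc] at r1
  have r2 := rot r1
  simp only [mul_assoc] at r2
  have r3 := rot r2
  simp only [mul_assoc] at r3
  have r4 := rot r3
  simp only [mul_assoc] at r4
  have r5 := rot r4
  simp only [mul_assoc] at r5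
  obtain ⟨m, hm1, hm2⟩ : ∃ m, (m = a ∨ m = b ∨ m = c ∨ m = d ∨ m = e ∨ m = f) ∧
      (a ≤ m ∧ b ≤ m ∧ c ≤ m ∧ d ≤ m ∧ e ≤ m ∧ f ≤ m) :=
    ⟨max a (max b (max c (max d (max e f)))), by omega, by omega⟩
  obtain ⟨l1, l2, l3, l4, l5, l6⟩ := hm2
  rcases hm1 with rfl | rfl | rfl | rfl | rfl | rfl
  · exact M6 ha hb hc hd hf (by omega) l3 l4 l5 (by omega) hbc hcd hde h
  · exact M6 hb hc hd he ha (by omega) l4 l5 l6 (by omega) hcd hde hef r1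
  · exact M6 hc hd he hf hb (by omega) l5 l6 l1 (by omega) hde hef hfa r2
  · exact M6 hd he hf ha hc (by omega) l6 l1 l2 (by omega) hef hfa hab r3
  · exact M6 he hf ha hb hd (by omega) l1 l2 l3 (by omega) hfa hab hbc r4
  · exact M6 hf ha hb hc he (by omega) l2 l3 l4 (by omega) hab hbc hcd r5

/-! Comparison of reduced words. -/

lemma cancel_right {p q : Equiv.Perm ℤ} {i : ℕ} (h : p = q * s i) : p * s i = q := by
  rw [h, mul_assoc, s_sq, mul_one]

lemma inj2 {a b c d : ℕ} (ha : 1 ≤ a) (hb : 1 ≤ b) (hc : 1 ≤ c) (hd : 1 ≤ d)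
    (hab : a ≠ b) (hcd : c ≠ d) (h : s a * s b = s c * s d) : a = c ∧ b = d := by
  by_cases hbd : b = d
  · subst hbd
    exact ⟨s_inj ha hc (mul_right_cancel h), rfl⟩
  · exfalso
    have h1 := cancel_right h
    rw [← one_mul (s c)] at h1
    have h2 := cancel_right h1
    simp only [mul_assoc] at h2
    exact R4 ha hb hd hc hab hbd hcd.symm h2

lemma ne_3_2 {a b c d e : ℕ} (ha : 1 ≤ a) (hb : 1 ≤ b) (hc : 1 ≤ c) (hd : 1 ≤ d) (he : 1 ≤ e)
    (hab : a ≠ b) (hbc : b ≠ c) : s a * s b * s c ≠ s d * s e := by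
  intro h
  by_cases hde : d = e
  · subst hde
    rw [s_sq, mul_assoc] at h
    exact R3 ha hb hc hab hbc h
  by_cases hce : c = e
  · subst hce
    have h1 := mul_right_cancel h
    rw [← one_mul (s d)] at h1
    by_cases hbd : b = d
    · subst hbd
      exact M1 ha (mul_right_cancel h1)
    · have h2 := cancel_right h1
      rw [mul_assoc] at h2
      exact R3 ha hb hd hab hbd h2
  · have h1 := cancel_right h
    rw [← one_mul (s d)] at h1
    have h2 := cancel_right h1
    simp only [mul_assoc] at h2
    exact R5 ha hb hc he hd hab hbc hce (Ne.symm hde) h2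

lemma inj3 {a b c d e f : ℕ} (ha : 1 ≤ a) (hb : 1 ≤ b) (hc : 1 ≤ c) (hd : 1 ≤ d) (he : 1 ≤ e)
    (hf : 1 ≤ f) (hab : a ≠ b) (hbc : b ≠ c) (hde : d ≠ e) (hef : e ≠ f)
    (h : s a * s b * s c = s d * s e * s f) : a = d ∧ b = e ∧ c = f := by
  by_cases hcf : c = f
  · subst hcf
    obtain ⟨h1, h2⟩ := inj2 ha hb hd he hab hde (mul_right_cancel h)
    exact ⟨h1, h2, rfl⟩
  · exfalso
    have h1 := cancel_right (cancel_right h)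
    rw [← one_mul (s d)] at h1
    have h2 := cancel_right h1
    simp only [mul_assoc] at h2
    exact R6 ha hb hc hf he hd hab hbc hcf hef.symm hde.symm h2

/-! Words of small length. -/

lemma word0 (n : ℕ) (p : Equiv.Perm ℤ) : burntWord n 0 p ↔ p = 1 := by
  constructor
  · rintro ⟨l, hl, -, rfl⟩
    rw [List.length_eq_zero_iff] at hl
    simp [hl]
  · rintro rfl
    exact ⟨[], by simp⟩

lemma word1 (n : ℕ) (p : Equiv.Perm ℤ) :
    burntWord n 1 p ↔ ∃ a, (1 ≤ a ∧ a ≤ n) ∧ p = s a := by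
  constructor
  · rintro ⟨l, hl, hb, rfl⟩
    obtain ⟨a, rfl⟩ := List.length_eq_one_iff.1 hl
    exact ⟨a, hb a (by simp), by simp⟩
  · rintro ⟨a, ha, rfl⟩
    exact ⟨[a], by simp, by simpa using ha, by simp⟩

lemma word2 (n : ℕ) (p : Equiv.Perm ℤ) :
    burntWord n 2 p ↔ ∃ a b, (1 ≤ a ∧ a ≤ n) ∧ (1 ≤ b ∧ b ≤ n) ∧ p = s a * s b := by
  constructor
  · rintro ⟨l, hl, hb, rfl⟩
    obtain ⟨a, b, rfl⟩ := List.length_eq_two.1 hl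
    exact ⟨a, b, hb a (by simp), hb b (by simp), by simp⟩
  · rintro ⟨a, b, ha, hb, rfl⟩
    exact ⟨[a, b], by simp, by simpa using ⟨ha, hb⟩, by simp⟩

lemma word3 (n : ℕ) (p : Equiv.Perm ℤ) :
    burntWord n 3 p ↔ ∃ a b c, (1 ≤ a ∧ a ≤ n) ∧ (1 ≤ b ∧ b ≤ n) ∧ (1 ≤ c ∧ c ≤ n) ∧
      p = s a * s b * s c := by
  constructor
  · rintro ⟨l, hl, hb, rfl⟩
    obtain ⟨a, b, c, rfl⟩ := List.length_eq_three.1 hl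
    exact ⟨a, b, c, hb a (by simp), hb b (by simp), hb c (by simp), by simp [mul_assoc]⟩
  · rintro ⟨a, b, c, ha, hb, hc, rfl⟩
    exact ⟨[a, b, c], by simp, by simpa using ⟨ha, hb, hc⟩, by simp [mul_assoc]⟩

lemma dist1 (n : ℕ) (p : Equiv.Perm ℤ) :
    burntDistEq n 1 p ↔ ∃ a, (1 ≤ a ∧ a ≤ n) ∧ p = s a := by
  rw [burntDistEq, word1]
  refine and_iff_left_of_imp ?_
  rintro ⟨a, ha, rfl⟩ m hm
  obtain rfl : m = 0 := by omega
  rw [word0]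
  exact M1 ha.1

lemma dist2 (n : ℕ) (p : Equiv.Perm ℤ) :
    burntDistEq n 2 p ↔ ∃ a b, (1 ≤ a ∧ a ≤ n) ∧ (1 ≤ b ∧ b ≤ n) ∧ a ≠ b ∧ p = s a * s b := by
  rw [burntDistEq, word2]
  constructor
  · rintro ⟨⟨a, b, ha, hb, rfl⟩, h⟩
    refine ⟨a, b, ha, hb, ?_, rfl⟩
    rintro rfl
    exact h 0 (by omega) ((word0 _ _).2 (s_sq a))
  · rintro ⟨a, b, ha, hb, hab, rfl⟩
    refine ⟨⟨a, b, ha, hb, rfl⟩, ?_⟩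
    intro m hm
    obtain rfl | rfl : m = 0 ∨ m = 1 := by omega
    · rw [word0]
      exact R2 ha.1 hb.1 hab
    · rw [word1]
      rintro ⟨c, hc, h⟩
      by_cases hbc : b = c
      · subst hbc
        rw [mul_eq_right] at h
        exact M1 ha.1 h
      · rw [← one_mul (s c)] at h
        have h2 := cancel_right h
        rw [mul_assoc] at h2
        exact R3 ha.1 hb.1 hc.1 hab hbc h2

lemma dist3 (n : ℕ) (p : Equiv.Perm ℤ) :
    burntDistEq n 3 p ↔ ∃ a b c, (1 ≤ a ∧ a ≤ n) ∧ (1 ≤ b ∧ b ≤ n) ∧ (1 ≤ c ∧ c ≤ n) ∧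
      a ≠ b ∧ b ≠ c ∧ p = s a * s b * s c := by
  rw [burntDistEq, word3]
  constructor
  · rintro ⟨⟨a, b, c, ha, hb, hc, rfl⟩, h⟩
    refine ⟨a, b, c, ha, hb, hc, ?_, ?_, rfl⟩
    · rintro rfl
      exact h 1 (by omega) ((word1 _ _).2 ⟨c, hc, by rw [s_sq, one_mul]⟩)
    · rintro rfl
      exact h 1 (by omega) ((word1 _ _).2 ⟨a, ha, by rw [mul_assoc, s_sq, mul_one]⟩)
  · rintro ⟨a, b, c, ha, hb, hc, hab, hbc, rfl⟩
    refine ⟨⟨a, b, c, ha, hb, hc, rfl⟩, ?_⟩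
    intro m hm
    obtain rfl | rfl | rfl : m = 0 ∨ m = 1 ∨ m = 2 := by omega
    · rw [word0, mul_assoc]
      exact R3 ha.1 hb.1 hc.1 hab hbc
    · rw [word1]
      rintro ⟨d, hd, h⟩
      by_cases hcd : c = d
      · subst hcd
        rw [mul_eq_right] at h
        exact R2 ha.1 hb.1 hab h
      · rw [← one_mul (s d)] at h
        have h2 := cancel_right h
        simp only [mul_assoc] at h2
        exact R4 ha.1 hb.1 hc.1 hd.1 hab hbc hcd h2
    · rw [word2]
      rintro ⟨d, e, hd, he, h⟩
      exact ne_3_2 ha.1 hb.1 hc.1 hd.1 he.1 hab hbc h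

/-- Counting through an injective parametrization by a finite set. -/
lemma count {ι : Type} (S : Finset ι) (g : ι → Equiv.Perm ℤ) (P : Equiv.Perm ℤ → Prop)
    (hg : Set.InjOn g S) (hP : ∀ p, P p ↔ ∃ i ∈ S, g i = p) :
    Nat.card {p // P p} = S.card := by
  have h : {p | P p} = g '' (S : Set ι) := by
    ext p
    simp [hP]
  have h2 : Nat.card {p // P p} = Set.ncard {p | P p} := rfl
  rw [h2, h, Set.ncard_image_of_injOn hg, Set.ncard_coe_finset]

end BurntAux

open BurntAux in
/-- For `n ≥ 1`, the number of signed permutations in `B_n` at burnt-pancake distance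
exactly `1` from the identity is `n`, at distance exactly `2` is `n(n-1)`, and at
distance exactly `3` is `n(n-1)²`. -/
theorem burnt_count_distance_small (n : ℕ) (hn : 1 ≤ n) :
    Nat.card {π : Equiv.Perm ℤ // burntDistEq n 1 π} = n
    ∧ Nat.card {π : Equiv.Perm ℤ // burntDistEq n 2 π} = n * (n - 1)
    ∧ Nat.card {π : Equiv.Perm ℤ // burntDistEq n 3 π} = n * (n - 1) ^ 2 := by
  have hcard : ∀ b ∈ Finset.Icc 1 n, ((Finset.Icc 1 n).erase b).card = n - 1 := by
    intro b hb
    rw [Finset.card_erase_of_mem hb]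
    simp
  refine ⟨?_, ?_, ?_⟩
  · rw [count (Finset.Icc 1 n) burntFlip]
    · simp
    · intro a ha b hb h
      simp only [Finset.coe_Icc, Set.mem_Icc] at ha hb
      exact s_inj ha.1 hb.1 h
    · intro p
      rw [dist1]
      simp only [Finset.mem_Icc, eq_comm]
  · rw [count ((Finset.Icc 1 n).sigma fun b => (Finset.Icc 1 n).erase b)
      (fun x => burntFlip x.1 * burntFlip x.2)]
    · rw [Finset.card_sigma, Finset.sum_congr rfl hcard]
      simp
    · rintro ⟨a, b⟩ h1 ⟨c, d⟩ h2 h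
      simp only [Finset.mem_coe, Finset.mem_sigma, Finset.mem_erase, Finset.mem_Icc] at h1 h2
      obtain ⟨rfl, rfl⟩ := inj2 h1.1.1 h1.2.2.1 h2.1.1 h2.2.2.1 h1.2.1.symm h2.2.1.symm h
      rfl
    · intro p
      rw [dist2]
      constructor
      · rintro ⟨a, b, ha, hb, hab, rfl⟩
        exact ⟨⟨a, b⟩, by simp [ha, hb, hab.symm], rfl⟩
      · rintro ⟨⟨a, b⟩, h, rfl⟩
        simp only [Finset.mem_sigma, Finset.mem_erase, Finset.mem_Icc] at h
        exact ⟨a, b, h.1, h.2.2, h.2.1.symm, rfl⟩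
  · rw [count ((Finset.Icc 1 n).sigma fun b =>
        (Finset.Icc 1 n).erase b ×ˢ (Finset.Icc 1 n).erase b)
      (fun x => burntFlip x.2.1 * burntFlip x.1 * burntFlip x.2.2)]
    · have h2 : ∀ b ∈ Finset.Icc 1 n,
          ((Finset.Icc 1 n).erase b ×ˢ (Finset.Icc 1 n).erase b).card = (n - 1) ^ 2 := by
        intro b hb
        rw [Finset.card_product, hcard b hb, sq]
      rw [Finset.card_sigma, Finset.sum_congr rfl h2]
      simp
    · rintro ⟨b, a, c⟩ h1 ⟨e, d, f⟩ h2 h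
      simp only [Finset.mem_coe, Finset.mem_sigma, Finset.mem_product, Finset.mem_erase,
        Finset.mem_Icc] at h1 h2
      obtain ⟨hb, ⟨hab, ha⟩, hcb, hc⟩ := h1
      obtain ⟨he, ⟨hde, hd⟩, hfe, hf⟩ := h2
      obtain ⟨rfl, rfl, rfl⟩ := inj3 ha.1 hb.1 hc.1 hd.1 he.1 hf.1 hab hcb.symm hde hfe.symm h
      rfl
    · intro p
      rw [dist3]
      constructor
      · rintro ⟨a, b, c, ha, hb, hc, hab, hbc, rfl⟩
        exact ⟨⟨b, a, c⟩, by simp [ha, hb, hc, hab, hbc.symm], rfl⟩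
      · rintro ⟨⟨b, a, c⟩, h, rfl⟩
        simp only [Finset.mem_sigma, Finset.mem_product, Finset.mem_erase, Finset.mem_Icc] at h
        obtain ⟨hb, ⟨hab, ha⟩, hcb, hc⟩ := h
        exact ⟨a, b, c, ha, hb, hc, hab, hcb.symm, rfl⟩
end

section
/- For n ≥ 1, the number of signed permutations in B_n at burnt-pancake distance exactly 4 from the identity equals n(n−1)²(2n−3)/2. -/
/-- The product of the flips in a word. -/
def bW (l : List ℕ) : Equiv.Perm ℤ := (l.map burntFlip).prod

lemma bW_nil : bW [] = 1 := rfl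
lemma bW_cons (a : ℕ) (l : List ℕ) : bW (a :: l) = burntFlip a * bW l := by simp [bW]
lemma bW_append (l k : List ℕ) : bW (l ++ k) = bW l * bW k := by simp [bW]
lemma bflip_apply (a : ℕ) (x : ℤ) : burntFlip a x = burntFun a x := rfl
lemma bflip_sq (a : ℕ) : burntFlip a * burntFlip a = 1 := by
  ext x; simp [bflip_apply, burntFun_invol (a : ℤ) x]
lemma bflip_inv (a : ℕ) : (burntFlip a)⁻¹ = burntFlip a :=
  inv_eq_of_mul_eq_one_left (bflip_sq a)
lemma bflip_flip (a : ℕ) (x : ℤ) : burntFlip a (burntFlip a x) = x := burntFun_invol a x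

lemma bW_fix (m : ℕ) (l : List ℕ) (h : ∀ i ∈ l, i < m) : bW l m = m := by
  induction l with
  | nil => rfl
  | cons a l ih =>
    rw [bW_cons, Equiv.Perm.mul_apply, ih (fun i hi => h i (by simp [hi])), bflip_apply]
    have := h a (by simp)
    unfold burntFun; split_ifs <;> omega

lemma bflip_top (m : ℕ) (hm : 1 ≤ m) : burntFlip m m = -1 := by
  rw [bflip_apply]; unfold burntFun; split_ifs <;> omega
lemma bflip_neg_one (m : ℕ) (hm : 1 ≤ m) : burntFlip m (-1) = m := by
  rw [bflip_apply]; unfold burntFun; split_ifs <;> omega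

/-- A reduced word fixing `-1` has at least three letters. -/
lemma fix_len (u : List ℕ) (hc : u.IsChain (· ≠ ·)) (h1 : ∀ i ∈ u, 1 ≤ i) (h0 : u ≠ [])
    (hf : bW u (-1) = -1) : 3 ≤ u.length := by
  match u with
  | [] => simp at h0
  | [a] =>
    have := h1 a (by simp)
    simp [bW, bflip_neg_one a this] at hf
  | [a, b] =>
    have ha := h1 a (by simp)
    have hb := h1 b (by simp)
    simp at hc
    simp [bW, bflip_neg_one b hb] at hf
    rw [bflip_apply] at hf; unfold burntFun at hf
    split_ifs at hf <;> omega
  | a :: b :: c :: l => simp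

lemma fix_three (a b c : ℕ) (ha : 1 ≤ a) (hb : 1 ≤ b) (hc : 1 ≤ c) 
    (hf : bW [a, b, c] (-1) = -1) : a = c ∧ b < a := by
  simp [bW, bflip_neg_one c hc] at hf
  have h2 : burntFlip b c = a := by
    rw [← bflip_flip a (burntFlip b c), hf, bflip_neg_one a ha]
  rw [bflip_apply] at h2; unfold burntFun at h2
  split_ifs at h2 <;> omega

lemma conj_one {G : Type*} [Group G] (a b : G) (h : a * b = 1) : b * a = 1 := by
  rw [mul_eq_one_iff_eq_inv] at h; simp [h]

lemma two_fix (m : ℕ) (u v : List ℕ) (hm : 1 ≤ m) (hv : ∀ i ∈ v, i < m)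
    (h : bW (m :: u ++ m :: v) = 1) : bW u (-1) = -1 := by
  have h' := DFunLike.congr_fun h (m : ℤ)
  rw [bW_append, bW_cons, bW_cons] at h'
  simp only [Equiv.Perm.mul_apply, bW_fix m v hv, bflip_top m hm, Equiv.Perm.one_apply] at h'
  rw [← bflip_flip m (bW u (-1)), h', bflip_top m hm]

lemma three_fix (m : ℕ) (u v w : List ℕ) (hm : 1 ≤ m) (hw : ∀ i ∈ w, i < m)
    (h : bW (m :: u ++ m :: v ++ m :: w) = 1) : bW u (burntFlip m (bW v (-1))) = -1 := by
  have := two_fix m (u ++ m :: v) w hm hw (by simpa using h)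
  rwa [bW_append, bW_cons] at this

lemma rot_one (u v : List ℕ) (h : bW (u ++ v) = 1) : bW (v ++ u) = 1 := by
  rw [bW_append] at *; exact conj_one _ _ h

lemma two_class (m a b c d : ℕ) (hb : 1 ≤ b) (hd : 1 ≤ d) (hba : b < a) (ham : a < m)
    (hdc : d < c) (hcm : c < m)
    (h : bW [m, a, b, a, m, c, d, c] = 1) : d = b ∧ c + a = m + b := by
  have key : ∀ x : ℤ, burntFun m (burntFun a (burntFun b (burntFun a (burntFun m x)))) =
      burntFun c (burntFun d (burntFun c x)) := by
    intro x
    have h' := DFunLike.congr_fun h (burntFun c (burntFun d (burntFun c x)))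
    simpa [bW, bflip_apply, burntFun_invol (c : ℤ) _, burntFun_invol (d : ℤ) _] using h'
  have inv : ∀ p q : ℕ, 1 ≤ q → q < p → ∀ x : ℤ, 1 ≤ x →
      burntFun p (burntFun q (burntFun p x)) =
        if p - q < x ∧ x ≤ p then x - (2 * p - q + 1) else x := by
    intro p q hq hp x hx
    unfold burntFun; split_ifs <;> omega
  have L : ∀ x : ℤ, 1 ≤ x → burntFun m (burntFun a (burntFun b (burntFun a (burntFun m x)))) =
      if m - a < x ∧ x ≤ m - a + b then x - (2 * (m - a) + b + 1) else x := by
    intro x hx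
    have : ∀ y : ℤ, y ≤ -1 → burntFun a (burntFun b (burntFun a y)) =
        if -a ≤ y ∧ y < b - a then y + (2 * a - b + 1) else y := by
      intro y hy
      unfold burntFun; split_ifs <;> omega
    by_cases hxm : x ≤ m
    · have e : burntFun m x = x - (m + 1) := by unfold burntFun; split_ifs <;> omega
      rw [e, this _ (by omega)]
      unfold burntFun; split_ifs <;> omega
    · have e : ∀ k : ℕ, k ≤ m → burntFun k x = x := by
        intro k hk; unfold burntFun; split_ifs <;> omega
      rw [e m le_rfl, e a (by omega), e b (by omega), e a (by omega), e m le_rfl]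
      split_ifs <;> omega
  have K : ∀ x : ℤ, 1 ≤ x → (if (m : ℤ) - a < x ∧ x ≤ m - a + b then x - (2 * (m - a) + b + 1) else x)
      = if (c : ℤ) - d < x ∧ x ≤ c then x - (2 * c - d + 1) else x := by
    intro x hx; rw [← L x hx, key, inv c d hd hdc x hx]
  have k1 := K c (by omega)
  have k2 := K (m - a + b) (by omega)
  have k3 := K (c - d + 1) (by omega)
  have k4 := K (m - a + 1) (by omega)
  split_ifs at k1 k2 k3 k4 <;> omega

lemma three_A (m a b : ℕ) (w : List ℕ) (ha : 1 ≤ a) (hb : 1 ≤ b) (ham : a < m) (hbm : b < m)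
    (hw : ∀ i ∈ w, i < m) (h : bW (m :: [a] ++ m :: [b] ++ m :: w) = 1) : False := by
  have := three_fix m [a] [b] w (by omega) hw h
  simp [bW, bflip_neg_one b hb] at this
  rw [bflip_apply, bflip_apply] at this
  unfold burntFun at this; split_ifs at this <;> omega

lemma three_B (m a b c d e : ℕ) (ha : 1 ≤ a) (hb : 1 ≤ b) (hc : 1 ≤ c) (hd : 1 ≤ d) (he : 1 ≤ e)
    (ham : a < m) (hbm : b < m) (hcm : c < m) (hdm : d < m) (hem : e < m)
    (h : bW (m :: [a] ++ m :: [b, c] ++ m :: [d, e]) = 1) : False := by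
  have h1 := three_fix m [a] [b, c] [d, e] (by omega) (by simp; omega) h
  have h2 := three_fix m [b, c] [d, e] [a] (by omega) (by simp; omega)
    (by simpa using rot_one (m :: [a]) (m :: [b, c] ++ m :: [d, e]) (by simpa using h))
  have h3 := three_fix m [d, e] [a] [b, c] (by omega) (by simp; omega)
    (by simpa using rot_one (m :: [a] ++ m :: [b, c]) (m :: [d, e]) (by simpa using h))
  simp [bW, bflip_neg_one _ hc] at h1
  simp [bW, bflip_neg_one _ he] at h2
  simp [bW, bflip_neg_one _ ha] at h3
  have g1 : burntFlip b c = burntFlip m a := by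
    rw [← bflip_neg_one a ha, ← h1, bflip_flip, bflip_flip]
  have g2 : burntFlip m (burntFlip d e) = burntFlip c b := by
    rw [← bflip_neg_one b hb, ← h2, bflip_flip, bflip_flip]
  have g3 : burntFlip m a = burntFlip e d := by
    rw [← bflip_neg_one d hd, ← h3, bflip_flip, bflip_flip]
  simp only [bflip_apply] at g1 g2 g3
  have e1 : burntFun m a = a - (m + 1) := by unfold burntFun; split_ifs <;> omega
  rw [e1] at g1 g3
  have c1 : c < b := by
    by_contra hh; unfold burntFun at g1; split_ifs at g1 <;> omega
  have c2 : d < e := by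
    by_contra hh; unfold burntFun at g3; split_ifs at g3 <;> omega
  have e2 : burntFun d e = e := by unfold burntFun; split_ifs <;> omega
  have e3 : burntFun c b = b := by unfold burntFun; split_ifs <;> omega
  rw [e2, e3] at g2
  unfold burntFun at g2; split_ifs at g2 <;> omega

lemma four_class (m a b c d : ℕ) (ha : 1 ≤ a) (hb : 1 ≤ b) (hc : 1 ≤ c) (hd : 1 ≤ d)
    (ham : a < m) (hbm : b < m) (hcm : c < m) (hdm : d < m)
    (h : bW [m, a, m, b, m, c, m, d] = 1) : a = c ∧ b = d ∧ a + b ≤ m := by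
  have S : ∀ p q r : ℕ, 1 ≤ p → p < m → 1 ≤ q → q < m → 1 ≤ r → r < m →
      bW [r, m, p, m, q] (-1) = -1 → q = r ∧ p + q ≤ m := by
    intro p q r hp hpm hq hqm hr hrm hh
    simp [bW, bflip_neg_one _ hq] at hh
    have g : burntFlip m (burntFlip p (burntFlip m q)) = r := by
      rw [← bflip_neg_one r hr, ← hh, bflip_flip]
    simp only [bflip_apply] at g
    have e1 : burntFun m q = q - (m + 1) := by unfold burntFun; split_ifs <;> omega
    rw [e1] at g
    unfold burntFun at g; split_ifs at g <;> omega
  have h1 := two_fix m [a, m, b, m, c] [d] (by omega) (by simp; omega) h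
  have h2 := two_fix m [b, m, c, m, d] [a] (by omega) (by simp; omega)
    (rot_one [m, a] [m, b, m, c, m, d] h)
  have r1 := S b c a hb hbm hc hcm ha ham h1
  have r2 := S c d b hc hcm hd hdm hb hbm h2
  omega
/-- Classification of trivial cyclically reduced words of length at most 8, starting at
their maximal letter. -/
lemma max_class (m : ℕ) (r : List ℕ) (hm : 1 ≤ m) (h1 : ∀ i ∈ r, 1 ≤ i) (hle : ∀ i ∈ r, i ≤ m)
    (hc : (m :: r ++ [m]).IsChain (· ≠ ·)) (hlen : r.length ≤ 7) (h : bW (m :: r) = 1) :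
    (∃ a b c, b < a ∧ a < m ∧ c + a = m + b ∧ r = [a, b, a, m, c, b, c]) ∨
    (∃ a b, a + b ≤ m ∧ r = [a, m, b, m, a, m, b]) := by
  have split : ∀ s : List ℕ, m ∈ s → (∀ i ∈ s, i ≤ m) →
      ∃ u v, s = u ++ m :: v ∧ ∀ i ∈ u, i < m := by
    intro s hs hl
    obtain ⟨u, v, e, hu⟩ := List.eq_append_cons_of_mem hs
    refine ⟨u, v, e, fun i hi => lt_of_le_of_ne (hl i (by simp [e, hi])) ?_⟩
    rintro rfl; exact hu hi
  have nosplit : ∀ s : List ℕ, m ∉ s → (∀ i ∈ s, i ≤ m) → ∀ i ∈ s, i < m := by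
    intro s hs hl i hi
    refine lt_of_le_of_ne (hl i hi) ?_
    rintro rfl; exact hs hi
  have ne : ∀ s : List ℕ, (m :: s ++ [m]).IsChain (· ≠ ·) → s ≠ [] := by
    rintro s hs rfl; simp at hs
  -- cutting a chain at an occurrence of `m`
  have cut : ∀ u v : List ℕ, (m :: (u ++ m :: v) ++ [m]).IsChain (· ≠ ·) →
      (m :: u ++ [m]).IsChain (· ≠ ·) ∧ (m :: v ++ [m]).IsChain (· ≠ ·) := by
    intro u v hh
    constructor
    · exact hh.infix ⟨[], v ++ [m], by simp⟩
    · exact hh.infix ⟨m :: u, [], by simp⟩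
  have inner : ∀ u : List ℕ, (m :: u ++ [m]).IsChain (· ≠ ·) → u.IsChain (· ≠ ·) := by
    intro u hh; exact hh.infix ⟨[m], [m], by simp⟩
  by_cases m1 : m ∈ r
  swap
  · exfalso
    have h' := DFunLike.congr_fun h (m : ℤ)
    rw [bW_cons, Equiv.Perm.mul_apply, bW_fix m r (nosplit r m1 hle), bflip_top m hm] at h'
    simp at h'
  obtain ⟨u, s, rfl, hu⟩ := split r m1 hle
  obtain ⟨cu, cs⟩ := cut u s hc
  have u0 := List.length_pos_of_ne_nil (ne u cu)
  have u1 : ∀ i ∈ u, 1 ≤ i := fun i hi => h1 i (by simp [hi])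
  have s1 : ∀ i ∈ s, 1 ≤ i := fun i hi => h1 i (by simp [hi])
  have sle : ∀ i ∈ s, i ≤ m := fun i hi => hle i (by simp [hi])
  simp only [List.length_append, List.length_cons] at hlen
  by_cases m2 : m ∈ s
  swap
  · left
    have hs := nosplit s m2 sle
    have fu := two_fix m u s hm hs (by simpa using h)
    have fs := two_fix m s u hm hu (by simpa using rot_one (m :: u) (m :: s) (by simpa using h))
    have lu := fix_len u (inner u cu) u1 (ne u cu) fu
    have ls := fix_len s (inner s cs) s1 (ne s cs) fs
    have lu' : u.length = 3 := by omega
    have ls' : s.length = 3 := by omega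
    obtain ⟨a, b, a', rfl⟩ := List.length_eq_three.1 lu'
    obtain ⟨c, d, c', rfl⟩ := List.length_eq_three.1 ls'
    simp only [List.mem_cons, List.not_mem_nil, or_false, forall_eq_or_imp, forall_eq] at u1 s1 hu hs
    obtain ⟨rfl, hba⟩ := fix_three a b a' u1.1 u1.2.1 u1.2.2 fu
    obtain ⟨rfl, hdc⟩ := fix_three c d c' s1.1 s1.2.1 s1.2.2 fs
    obtain ⟨rfl, e⟩ := two_class m a b c d u1.2.1 s1.2.1 hba hu.1 hdc hs.1 h
    exact ⟨a, d, c, hba, hu.1, e, rfl⟩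
  obtain ⟨v, t, rfl, hv⟩ := split s m2 sle
  obtain ⟨cv, ct⟩ := cut v t cs
  have v0 := List.length_pos_of_ne_nil (ne v cv)
  have t0 := List.length_pos_of_ne_nil (ne t ct)
  have v1 : ∀ i ∈ v, 1 ≤ i := fun i hi => s1 i (by simp [hi])
  have t1 : ∀ i ∈ t, 1 ≤ i := fun i hi => s1 i (by simp [hi])
  have tle : ∀ i ∈ t, i ≤ m := fun i hi => sle i (by simp [hi])
  simp only [List.length_append, List.length_cons] at hlen
  by_cases m3 : m ∈ t
  swap
  · exfalso
    have ht := nosplit t m3 tle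
    have A : ∀ u v w : List ℕ, u.length = 1 → v.length = 1 → (∀ i ∈ u, 1 ≤ i) → (∀ i ∈ v, 1 ≤ i) →
        (∀ i ∈ u, i < m) → (∀ i ∈ v, i < m) → (∀ i ∈ w, i < m) →
        bW (m :: u ++ m :: v ++ m :: w) = 1 → False := by
      intro u v w lu lv u1 v1 hu hv hw hh
      obtain ⟨a, rfl⟩ := List.length_eq_one_iff.1 lu
      obtain ⟨b, rfl⟩ := List.length_eq_one_iff.1 lv
      exact three_A m a b w (u1 a (by simp)) (v1 b (by simp)) (hu a (by simp)) (hv b (by simp)) hw hh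
    have B : ∀ u v w : List ℕ, u.length = 1 → v.length = 2 → w.length = 2 →
        (∀ i ∈ u, 1 ≤ i) → (∀ i ∈ v, 1 ≤ i) → (∀ i ∈ w, 1 ≤ i) →
        (∀ i ∈ u, i < m) → (∀ i ∈ v, i < m) → (∀ i ∈ w, i < m) →
        bW (m :: u ++ m :: v ++ m :: w) = 1 → False := by
      intro u v w lu lv lw u1 v1 w1 hu hv hw hh
      obtain ⟨a, rfl⟩ := List.length_eq_one_iff.1 lu
      obtain ⟨b, c, rfl⟩ := List.length_eq_two.1 lv
      obtain ⟨d, e, rfl⟩ := List.length_eq_two.1 lw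
      simp only [List.mem_cons, List.not_mem_nil, or_false, forall_eq_or_imp, forall_eq]
        at u1 v1 w1 hu hv hw
      exact three_B m a b c d e u1 v1.1 v1.2 w1.1 w1.2 hu hv.1 hv.2 hw.1 hw.2 hh
    have e1 : bW (m :: u ++ m :: v ++ m :: t) = 1 := by simpa using h
    have e2 : bW (m :: v ++ m :: t ++ m :: u) = 1 := by
      simpa using rot_one (m :: u) (m :: v ++ m :: t) (by simpa using h)
    have e3 : bW (m :: t ++ m :: u ++ m :: v) = 1 := by
      simpa using rot_one (m :: u ++ m :: v) (m :: t) (by simpa using h)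
    by_cases lu : u.length = 1
    · by_cases lv : v.length = 1
      · exact A u v t lu lv u1 v1 hu hv ht e1
      · by_cases lt : t.length = 1
        · exact A t u v lt lu t1 u1 ht hu hv e3
        · exact B u v t lu (by omega) (by omega) u1 v1 t1 hu hv ht e1
    · by_cases lv : v.length = 1
      · by_cases lt : t.length = 1
        · exact A v t u lv lt v1 t1 hv ht hu e2
        · exact B v t u lv (by omega) (by omega) v1 t1 u1 hv ht hu e2
      · exact B t u v (by omega) (by omega) (by omega) t1 u1 v1 ht hu hv e3
  obtain ⟨w, z, rfl, hw⟩ := split t m3 tle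
  obtain ⟨cw, cz⟩ := cut w z ct
  have w0 := List.length_pos_of_ne_nil (ne w cw)
  have z0 := List.length_pos_of_ne_nil (ne z cz)
  simp only [List.length_append, List.length_cons] at hlen
  obtain ⟨a, rfl⟩ := List.length_eq_one_iff.1 (show u.length = 1 by omega)
  obtain ⟨b, rfl⟩ := List.length_eq_one_iff.1 (show v.length = 1 by omega)
  obtain ⟨c, rfl⟩ := List.length_eq_one_iff.1 (show w.length = 1 by omega)
  obtain ⟨d, rfl⟩ := List.length_eq_one_iff.1 (show z.length = 1 by omega)
  have dm : d < m := by
    refine lt_of_le_of_ne (tle d (by simp)) ?_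
    rintro rfl; simp at cz
  obtain ⟨rfl, rfl, e⟩ := four_class m a b c d (u1 a (by simp)) (v1 b (by simp)) (t1 c (by simp))
    (t1 d (by simp)) (hu a (by simp)) (hv b (by simp)) (hw c (by simp)) dm h
  exact Or.inr ⟨a, b, e, rfl⟩

lemma exists_max_split (l : List ℕ) (h0 : l ≠ []) :
    ∃ m p q, l = p ++ m :: q ∧ ∀ i ∈ l, i ≤ m := by
  obtain ⟨m, hm, hmax⟩ := l.toFinset.exists_max_image id (by simpa using h0)
  obtain ⟨p, q, e⟩ := List.append_of_mem (List.mem_toFinset.1 hm)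
  exact ⟨m, p, q, e, fun i hi => hmax i (List.mem_toFinset.2 hi)⟩

/-- cyclically reduced words: rotating to the maximum -/
lemma cyc_class (l : List ℕ) (h0 : l ≠ []) (h1 : ∀ i ∈ l, 1 ≤ i) (hlen : l.length ≤ 8)
    (hc : (l ++ l).IsChain (· ≠ ·)) (h : bW l = 1) :
    ∃ m p q, l = p ++ m :: q ∧
    ((∃ a b c, b < a ∧ a < m ∧ c + a = m + b ∧ q ++ p = [a, b, a, m, c, b, c]) ∨
    (∃ a b, a + b ≤ m ∧ q ++ p = [a, m, b, m, a, m, b])) := by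
  obtain ⟨m, p, q, rfl, hmax⟩ := exists_max_split l h0
  refine ⟨m, p, q, rfl, max_class m (q ++ p) (h1 m (by simp)) ?_ ?_ ?_ ?_ ?_⟩
  · intro i hi; apply h1; simp at hi ⊢; tauto
  · intro i hi; apply hmax; simp at hi ⊢; tauto
  · exact hc.infix ⟨p, q, by simp⟩
  · simp at hlen ⊢; omega
  · simpa using rot_one p (m :: q) h

/-- Nonempty reduced words of length at most 7 are nontrivial. -/
lemma no_short (n : ℕ) : ∀ l : List ℕ, l.length = n → n ≤ 7 → l ≠ [] → (∀ i ∈ l, 1 ≤ i) →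
    l.IsChain (· ≠ ·) → bW l ≠ 1 := by
  induction n using Nat.strong_induction_on with
  | _ n ih =>
  intro l hn h7 h0 h1 hc h
  obtain ⟨a, k, rfl⟩ := List.exists_cons_of_ne_nil h0
  by_cases hk : k = []
  · subst hk
    have h' := DFunLike.congr_fun h (-1 : ℤ)
    have := h1 a (by simp)
    simp [bW, bflip_neg_one a this] at h'
  obtain ⟨k', b, rfl⟩ : ∃ k' b, k = k' ++ [b] := ⟨_, _, (List.dropLast_append_getLast hk).symm⟩
  by_cases hab : b = a
  · subst hab
    have k0 : k' ≠ [] := by rintro rfl; simp at hc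
    refine ih k'.length (by simp at hn; omega) k' rfl (by simp at hn; omega) k0 ?_ ?_ ?_
    · intro i hi; exact h1 i (by simp [hi])
    · exact hc.infix ⟨[b], [b], by simp⟩
    · rw [bW_cons, bW_append] at h
      have h2 := conj_one _ _ h
      simpa [bW, mul_assoc, bflip_sq] using h2
  · have hcc : ((a :: (k' ++ [b])) ++ (a :: (k' ++ [b]))).IsChain (· ≠ ·) := by
      refine List.IsChain.append hc hc ?_
      intro x hx y hy
      rw [← List.cons_append, List.getLast?_concat] at hx
      simp at hx hy
      subst hx hy; exact hab
    obtain ⟨m, p, q, e, hh⟩ := cyc_class _ h0 h1 (by omega) hcc h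
    have e' := congrArg List.length e
    rw [hn] at e'
    rcases hh with ⟨_, _, _, _, _, _, hh⟩ | ⟨_, _, _, hh⟩ <;>
    · have := congrArg List.length hh
      simp at this e'; omega

lemma cons_eq (f : ℕ) (l : List ℕ) (P : Equiv.Perm ℤ) (h : bW l = burntFlip f * P) :
    bW (f :: l) = P := by
  rw [bW_cons, h, ← mul_assoc, bflip_sq, one_mul]

/-- short words cannot equal longer reduced ones -/
lemma no_shorter (l' : List ℕ) : ∀ l : List ℕ, (∀ i ∈ l, 1 ≤ i) → (∀ i ∈ l', 1 ≤ i) →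
    l.IsChain (· ≠ ·) → l'.length < l.length → l.length + l'.length ≤ 7 → bW l ≠ bW l' := by
  induction l' with
  | nil =>
    intro l h1 _ hc hl h7 h
    exact no_short _ l rfl (by simpa using h7) (by rintro rfl; simp at hl) h1 hc h
  | cons f l' ih =>
    intro l h1 h1' hc hl h7 h
    simp only [List.length_cons] at hl h7
    rw [bW_cons] at h
    have h' := cons_eq f l _ h
    match l with
    | [] => simp at hl
    | d :: k =>
      simp only [List.length_cons] at hl h7
      by_cases hd : f = d
      · subst hd
        refine ih k (fun i hi => h1 i (by simp [hi])) (fun i hi => h1' i (by simp [hi]))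
          hc.tail (by omega) (by omega) ?_
        rw [bW_cons] at h; exact mul_left_cancel h
      · refine ih (f :: d :: k) ?_ (fun i hi => h1' i (by simp [hi])) ?_
          (by simp; omega) (by simp; omega) h'
        · intro i hi
          rcases List.mem_cons.1 hi with rfl | hi
          · exact h1' _ (by simp)
          · exact h1 i hi
        · exact List.isChain_cons_cons.2 ⟨hd, hc⟩

/-- uniqueness of reduced words of small total length -/
lemma short_unique (l' : List ℕ) : ∀ l : List ℕ, (∀ i ∈ l, 1 ≤ i) → (∀ i ∈ l', 1 ≤ i) →
    l.IsChain (· ≠ ·) → l'.IsChain (· ≠ ·) → l.length + l'.length ≤ 7 → bW l = bW l' → l = l' := by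
  induction l' with
  | nil =>
    intro l h1 _ hc _ h7 h
    by_contra h0
    exact no_short _ l rfl (by simpa using h7) h0 h1 hc h
  | cons f l' ih =>
    intro l h1 h1' hc hc' h7 h
    simp only [List.length_cons] at h7
    match l with
    | [] => exact absurd h.symm (no_short _ (f :: l') rfl (by simp at h7 ⊢; omega) (by simp) h1' hc')
    | d :: k =>
      simp only [List.length_cons] at h7
      rw [bW_cons f] at h
      by_cases hd : f = d
      · subst hd
        rw [ih k (fun i hi => h1 i (by simp [hi])) (fun i hi => h1' i (by simp [hi]))
          hc.tail hc'.tail (by omega) ?_]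
        rw [bW_cons] at h; exact mul_left_cancel h
      · have h' := cons_eq f _ _ h
        have := ih (f :: d :: k) ?_ (fun i hi => h1' i (by simp [hi])) ?_ hc'.tail
          (by simp; omega) h'
        · subst this; simp at hc'
        · intro i hi
          rcases List.mem_cons.1 hi with rfl | hi
          · exact h1' _ (by simp)
          · exact h1 i hi
        · exact List.isChain_cons_cons.2 ⟨hd, hc⟩

/-- The words discarded from each pair of coinciding words. -/
def Bad (a b c d : ℕ) : Prop :=
  (a < b ∧ b < c ∧ d + b = c + a) ∨ (a = c ∧ b < a ∧ a < d) ∨ (b = d ∧ a + c ≤ b)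

lemma four_unique (a b c d a' b' c' d' : ℕ) (h1 : ∀ i ∈ [a, b, c, d], 1 ≤ i)
    (h1' : ∀ i ∈ [a', b', c', d'], 1 ≤ i) (hc : [a, b, c, d].IsChain (· ≠ ·))
    (hc' : [a', b', c', d'].IsChain (· ≠ ·)) (hB : ¬ Bad a b c d) (hB' : ¬ Bad a' b' c' d')
    (h : bW [a, b, c, d] = bW [a', b', c', d']) :
    a = a' ∧ b = b' ∧ c = c' ∧ d = d' := by
  by_cases ha : a = a'
  · subst ha
    rw [bW_cons, bW_cons a] at h
    have := short_unique [b', c', d'] [b, c, d] (fun i hi => h1 i (List.mem_cons_of_mem _ hi))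
      (fun i hi => h1' i (List.mem_cons_of_mem _ hi)) hc.tail hc'.tail (by simp)
      (mul_left_cancel h)
    simpa using this
  by_cases hd : d = d'
  · subst hd
    have e : bW [a, b, c] = bW [a', b', c'] := by
      rw [show [a, b, c, d] = [a, b, c] ++ [d] from rfl,
        show [a', b', c', d] = [a', b', c'] ++ [d] from rfl, bW_append, bW_append] at h
      exact mul_right_cancel h
    have := short_unique [a', b', c'] [a, b, c] (fun i hi => h1 i (by simp at hi ⊢; tauto))
      (fun i hi => h1' i (by simp at hi ⊢; tauto)) (hc.infix ⟨[], [d], rfl⟩)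
      (hc'.infix ⟨[], [d], rfl⟩) (by simp) e
    simp at this; exact absurd this.1 ha
  exfalso
  have e : bW [a, b, c, d, d', c', b', a'] = 1 := by
    rw [show [a, b, c, d, d', c', b', a'] = [a, b, c, d] ++ [d', c', b', a'] from rfl, bW_append, h]
    have : bW [d', c', b', a'] = (bW [a', b', c', d'])⁻¹ := by
      simp [bW, bflip_inv, mul_assoc]
    rw [this, mul_inv_cancel]
  simp only [List.mem_cons, List.not_mem_nil, or_false, forall_eq_or_imp, forall_eq] at h1 h1'
  simp at hc hc'
  obtain ⟨m, p, q, e1, hh⟩ := cyc_class _ (by simp) (by simp; omega) (by simp) (by simp; omega) e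
  unfold Bad at hB hB'
  match p, e1, hh with
  | [], e1, hh =>
    simp at e1; obtain ⟨rfl, rfl⟩ := e1
    rcases hh with ⟨x, y, z, h2, h3, h4, hh⟩ | ⟨x, y, h2, hh⟩ <;> (simp at hh; omega)
  | [_], e1, hh =>
    simp at e1; obtain ⟨rfl, rfl, rfl⟩ := e1
    rcases hh with ⟨x, y, z, h2, h3, h4, hh⟩ | ⟨x, y, h2, hh⟩ <;> (simp at hh; omega)
  | [_, _], e1, hh =>
    simp at e1; obtain ⟨rfl, rfl, rfl, rfl⟩ := e1
    rcases hh with ⟨x, y, z, h2, h3, h4, hh⟩ | ⟨x, y, h2, hh⟩ <;> (simp at hh; omega)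
  | [_, _, _], e1, hh =>
    simp at e1; obtain ⟨rfl, rfl, rfl, rfl, rfl⟩ := e1
    rcases hh with ⟨x, y, z, h2, h3, h4, hh⟩ | ⟨x, y, h2, hh⟩ <;> (simp at hh; omega)
  | [_, _, _, _], e1, hh =>
    simp at e1; obtain ⟨rfl, rfl, rfl, rfl, rfl, rfl⟩ := e1
    rcases hh with ⟨x, y, z, h2, h3, h4, hh⟩ | ⟨x, y, h2, hh⟩ <;> (simp at hh; omega)
  | [_, _, _, _, _], e1, hh =>
    simp at e1; obtain ⟨rfl, rfl, rfl, rfl, rfl, rfl, rfl⟩ := e1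
    rcases hh with ⟨x, y, z, h2, h3, h4, hh⟩ | ⟨x, y, h2, hh⟩ <;> (simp at hh; omega)
  | [_, _, _, _, _, _], e1, hh =>
    simp at e1; obtain ⟨rfl, rfl, rfl, rfl, rfl, rfl, rfl, rfl⟩ := e1
    rcases hh with ⟨x, y, z, h2, h3, h4, hh⟩ | ⟨x, y, h2, hh⟩ <;> (simp at hh; omega)
  | [_, _, _, _, _, _, _], e1, hh =>
    simp at e1; obtain ⟨rfl, rfl, rfl, rfl, rfl, rfl, rfl, rfl, rfl⟩ := e1
    rcases hh with ⟨x, y, z, h2, h3, h4, hh⟩ | ⟨x, y, h2, hh⟩ <;> (simp at hh; omega)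
  | _ :: _ :: _ :: _ :: _ :: _ :: _ :: _ :: p, e1, hh =>
    simp at e1
lemma conj_form (p q : ℕ) (hq : 1 ≤ q) (hp : q < p) (x : ℤ) :
    burntFun p (burntFun q (burntFun p x)) =
      if p - q < x ∧ x ≤ p then x - (2 * p - q + 1)
      else if -p ≤ x ∧ x < q - p then x + (2 * p - q + 1) else x := by
  unfold burntFun; split_ifs <;> omega

lemma rel_two (m a b c : ℕ) (hb : 1 ≤ b) (hba : b < a) (ham : a < m) (e : c + a = m + b) :
    bW [m, a, b, a, m] = bW [c, b, c] := by
  ext x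
  simp only [bW, List.map_cons, List.map_nil, List.prod_cons, List.prod_nil, mul_one,
    Equiv.Perm.mul_apply, bflip_apply]
  rw [conj_form c b hb (by omega), conj_form a b hb hba]
  have ec : (c : ℤ) = m + b - a := by omega
  rw [ec]
  by_cases h1 : 1 ≤ x ∧ x ≤ m
  · have e1 : burntFun m x = x - (m + 1) := by unfold burntFun; split_ifs <;> omega
    rw [e1]; unfold burntFun; split_ifs <;> omega
  by_cases h2 : -m ≤ x ∧ x ≤ -1
  · have e1 : burntFun m x = x + (m + 1) := by unfold burntFun; split_ifs <;> omega
    rw [e1]; unfold burntFun; split_ifs <;> omega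
  have e1 : burntFun m x = x := by unfold burntFun; split_ifs <;> omega
  rw [e1]; unfold burntFun; split_ifs <;> omega

lemma rel_four (m a b : ℕ) (ha : 1 ≤ a) (hb : 1 ≤ b) (e : a + b ≤ m) :
    bW [a, m, b, m] = bW [m, b, m, a] := by
  ext x
  simp only [bW, List.map_cons, List.map_nil, List.prod_cons, List.prod_nil, mul_one,
    Equiv.Perm.mul_apply, bflip_apply]
  rw [conj_form m b hb (by omega), conj_form m b hb (by omega)]
  unfold burntFun; split_ifs <;> omega

lemma rel_B (m a b c : ℕ) (hb : 1 ≤ b) (hba : b < a) (ham : a < m) (e : c + a = m + b) :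
    bW [a, b, a, m] = bW [m, c, b, c] := by
  have h := rel_two m a b c hb hba ham e
  rw [bW_cons m [c, b, c], ← h, bW_cons m, ← mul_assoc, bflip_sq, one_mul]

lemma rel_A (m a b c : ℕ) (hb : 1 ≤ b) (hba : b < a) (ham : a < m) (e : c + a = m + b) :
    bW [b, a, m, c] = bW [a, m, c, b] := by
  have h := rel_two m a b c hb hba ham e
  have h2 : bW [a] * bW [m] * bW [m, a, b, a, m] * bW [c]
      = bW [a] * bW [m] * bW [c, b, c] * bW [c] := by rw [h]
  simp only [← bW_append] at h2
  simp only [bW, List.cons_append, List.nil_append, List.map_cons, List.map_nil, List.prod_cons,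
    List.prod_nil, mul_one, bflip_sq] at h2 ⊢
  rw [← mul_assoc (burntFlip m) (burntFlip m), bflip_sq, one_mul,
    ← mul_assoc (burntFlip a) (burntFlip a), bflip_sq, one_mul] at h2
  exact h2

lemma bad_fix (n a b c d : ℕ) (h1 : ∀ i ∈ [a, b, c, d], 1 ≤ i ∧ i ≤ n) (hB : Bad a b c d) :
    ∃ a' b' c' d', (∀ i ∈ [a', b', c', d'], 1 ≤ i ∧ i ≤ n) ∧ [a', b', c', d'].IsChain (· ≠ ·) ∧
      ¬ Bad a' b' c' d' ∧ bW [a, b, c, d] = bW [a', b', c', d'] := by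
  simp only [List.mem_cons, List.not_mem_nil, or_false, forall_eq_or_imp, forall_eq] at h1
  rcases hB with ⟨h2, h3, h4⟩ | ⟨rfl, h2, h3⟩ | ⟨rfl, h2⟩
  · refine ⟨b, c, d, a, by simp; omega, by simp; omega, by unfold Bad; omega, ?_⟩
    exact rel_A c b a d (by omega) h2 h3 h4
  · refine ⟨d, d + b - a, b, d + b - a, by simp; omega, by simp; omega, by unfold Bad; omega, ?_⟩
    exact rel_B d a b _ (by omega) h2 h3 (by omega)
  · refine ⟨b, c, b, a, by simp; omega, by simp; omega, by unfold Bad; omega, ?_⟩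
    exact rel_four b a c (by omega) (by omega) h2

instance (a b c d : ℕ) : Decidable (Bad a b c d) := by unfold Bad; infer_instance

/-- reduced quadruples -/
def redF (n : ℕ) : Finset (((ℕ × ℕ) × ℕ) × ℕ) :=
  (((((Finset.Icc 1 n ×ˢ Finset.Icc 1 n).filter (fun p => p.2 ≠ p.1)) ×ˢ
    Finset.Icc 1 n).filter (fun p => p.2 ≠ p.1.2)) ×ˢ Finset.Icc 1 n).filter (fun p => p.2 ≠ p.1.2)

def qW (p : ((ℕ × ℕ) × ℕ) × ℕ) : Equiv.Perm ℤ := bW [p.1.1.1, p.1.1.2, p.1.2, p.2]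

lemma mem_redF (n a b c d : ℕ) : (((a, b), c), d) ∈ redF n ↔
    (∀ i ∈ [a, b, c, d], 1 ≤ i ∧ i ≤ n) ∧ [a, b, c, d].IsChain (· ≠ ·) := by
  simp [redF]; omega

/-- canonical quadruples -/
def canF (n : ℕ) : Finset (((ℕ × ℕ) × ℕ) × ℕ) :=
  (redF n).filter (fun p => ¬ Bad p.1.1.1 p.1.1.2 p.1.2 p.2)

lemma mem_canF (n a b c d : ℕ) : (((a, b), c), d) ∈ canF n ↔
    (∀ i ∈ [a, b, c, d], 1 ≤ i ∧ i ≤ n) ∧ [a, b, c, d].IsChain (· ≠ ·) ∧ ¬ Bad a b c d := by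
  rw [canF, Finset.mem_filter, mem_redF, and_assoc]

lemma dist_iff (n : ℕ) (π : Equiv.Perm ℤ) : burntDistEq n 4 π ↔ ∃ p ∈ canF n, qW p = π := by
  constructor
  · rintro ⟨⟨l, hl, h1, rfl⟩, hmin⟩
    obtain ⟨a, b, c, d, rfl⟩ : ∃ a b c d, l = [a, b, c, d] := by
      match l, hl with
      | [a, b, c, d], _ => exact ⟨a, b, c, d, rfl⟩
    have hmem := h1
    simp only [List.mem_cons, List.not_mem_nil, or_false, forall_eq_or_imp, forall_eq] at h1
    have hc : [a, b, c, d].IsChain (· ≠ ·) := by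
      simp only [List.isChain_cons_cons, List.isChain_singleton, and_true]
      refine ⟨?_, ?_, ?_⟩ <;> rintro rfl <;> refine hmin 2 (by norm_num) ?_
      · exact ⟨[c, d], rfl, by simp; omega, by simp [← mul_assoc, bflip_sq]⟩
      · refine ⟨[a, d], rfl, by simp; omega, ?_⟩
        simp [← mul_assoc]; simp [mul_assoc, bflip_sq]
      · exact ⟨[a, b], rfl, by simp; omega, by simp [bflip_sq]⟩
    by_cases hB : Bad a b c d
    · obtain ⟨a', b', c', d', h2, h3, h4, h5⟩ := bad_fix n a b c d hmem hB
      exact ⟨(((a', b'), c'), d'), (mem_canF ..).2 ⟨h2, h3, h4⟩, h5.symm⟩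
    · exact ⟨(((a, b), c), d), (mem_canF ..).2 ⟨hmem, hc, hB⟩, rfl⟩
  · rintro ⟨⟨⟨⟨a, b⟩, c⟩, d⟩, hm, rfl⟩
    obtain ⟨h1, h2, h3⟩ := (mem_canF ..).1 hm
    refine ⟨⟨[a, b, c, d], rfl, h1, rfl⟩, ?_⟩
    rintro k hk ⟨l, hl, hl1, hl2⟩
    exact no_shorter l [a, b, c, d] (fun i hi => (h1 i hi).1) (fun i hi => (hl1 i hi).1) h2
      (by simp; omega) (by simp; omega) hl2.symm

lemma qW_inj (n : ℕ) : Set.InjOn qW (canF n : Set (((ℕ × ℕ) × ℕ) × ℕ)) := by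
  rintro ⟨⟨⟨a, b⟩, c⟩, d⟩ h ⟨⟨⟨a', b'⟩, c'⟩, d'⟩ h' e
  obtain ⟨h1, h2, h3⟩ := (mem_canF ..).1 h
  obtain ⟨h1', h2', h3'⟩ := (mem_canF ..).1 h'
  obtain ⟨rfl, rfl, rfl, rfl⟩ := four_unique a b c d a' b' c' d' (fun i hi => (h1 i hi).1)
    (fun i hi => (h1' i hi).1) h2 h2' h3 h3' e
  rfl

lemma card_dist (n : ℕ) : Nat.card {π : Equiv.Perm ℤ // burntDistEq n 4 π} = (canF n).card := by
  classical
  rw [← Finset.card_image_of_injOn (qW_inj n), Nat.card_congr (Equiv.subtypeEquivRight (dist_iff n)),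
    ← Nat.card_eq_finsetCard]
  simp only [Finset.mem_image]

lemma card_step {α : Type*} (n : ℕ) (S : Finset α) (f : α → ℕ)
    (hf : ∀ s ∈ S, f s ∈ Finset.Icc 1 n) :
    ((S ×ˢ Finset.Icc 1 n).filter (fun p => p.2 ≠ f p.1)).card = S.card * (n - 1) := by
  rw [Finset.card_filter, Finset.sum_product, Finset.sum_const_nat (m := n - 1)]
  intro s hs
  dsimp only
  rw [← Finset.card_filter, Finset.filter_ne', Finset.card_erase_of_mem (hf s hs)]
  simp

lemma card_redF (n : ℕ) : (redF n).card = n * (n - 1) * (n - 1) * (n - 1) := by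
  refine (card_step n _ Prod.snd ?_).trans ?_
  · simp; omega
  congr 1
  refine (card_step n _ Prod.snd ?_).trans ?_
  · simp; omega
  congr 1
  refine (card_step n _ id ?_).trans ?_
  · simp
  simp

def badA (n : ℕ) : Finset (((ℕ × ℕ) × ℕ) × ℕ) :=
  (redF n).filter (fun p => p.1.1.1 < p.1.1.2 ∧ p.1.1.2 < p.1.2 ∧ p.2 + p.1.1.2 = p.1.2 + p.1.1.1)
def badB (n : ℕ) : Finset (((ℕ × ℕ) × ℕ) × ℕ) :=
  (redF n).filter (fun p => p.1.1.1 = p.1.2 ∧ p.1.1.2 < p.1.1.1 ∧ p.1.1.1 < p.2)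
def badC (n : ℕ) : Finset (((ℕ × ℕ) × ℕ) × ℕ) :=
  (redF n).filter (fun p => p.1.1.2 = p.2 ∧ p.1.1.1 + p.1.2 ≤ p.1.1.2)

/-- triples `z < y < x < n` -/
def tri (n : ℕ) : Finset (Σ _ : ℕ, Σ _ : ℕ, ℕ) :=
  (Finset.range n).sigma fun x => (Finset.range x).sigma fun y => Finset.range y

lemma six_tri (n : ℕ) : 6 * ((tri n).card : ℤ) = n * (n - 1) * (n - 2) := by
  have h2 : ∀ m : ℕ, 2 * (∑ y ∈ Finset.range m, (y : ℤ)) = m * (m - 1) := by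
    intro m
    induction m with
    | zero => simp
    | succ k ih => rw [Finset.sum_range_succ, mul_add, ih]; push_cast; ring
  have h3 : ∀ m : ℕ, 6 * (∑ x ∈ Finset.range m, ∑ y ∈ Finset.range x, (y : ℤ))
      = m * (m - 1) * (m - 2) := by
    intro m
    induction m with
    | zero => simp
    | succ k ih =>
      rw [Finset.sum_range_succ, mul_add, ih]; have := h2 k; push_cast; linear_combination 3 * this
  rw [← h3 n, tri]
  simp [Finset.card_sigma]

lemma card_badA (n : ℕ) : (badA n).card = (tri n).card := by
  refine Finset.card_bij' (fun p _ => ⟨p.1.2 - 1, p.1.1.2 - 1, p.1.1.1 - 1⟩)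
    (fun q _ => (((q.2.2 + 1, q.2.1 + 1), q.1 + 1), q.1 + q.2.2 - q.2.1 + 1)) ?_ ?_ ?_ ?_
  · rintro ⟨⟨⟨a, b⟩, c⟩, d⟩ h
    rw [badA, Finset.mem_filter, mem_redF] at h
    simp at h; simp [tri]; omega
  · rintro ⟨x, y, z⟩ h
    simp [tri] at h
    rw [badA, Finset.mem_filter, mem_redF]
    simp; omega
  · rintro ⟨⟨⟨a, b⟩, c⟩, d⟩ h
    rw [badA, Finset.mem_filter, mem_redF] at h
    simp at h ⊢; omega
  · rintro ⟨x, y, z⟩ h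
    simp

lemma card_badB (n : ℕ) : (badB n).card = (tri n).card := by
  refine Finset.card_bij' (fun p _ => ⟨p.2 - 1, p.1.1.1 - 1, p.1.1.2 - 1⟩)
    (fun q _ => (((q.2.1 + 1, q.2.2 + 1), q.2.1 + 1), q.1 + 1)) ?_ ?_ ?_ ?_
  · rintro ⟨⟨⟨a, b⟩, c⟩, d⟩ h
    rw [badB, Finset.mem_filter, mem_redF] at h
    simp at h; simp [tri]; omega
  · rintro ⟨x, y, z⟩ h
    simp [tri] at h
    rw [badB, Finset.mem_filter, mem_redF]
    simp; omega
  · rintro ⟨⟨⟨a, b⟩, c⟩, d⟩ h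
    rw [badB, Finset.mem_filter, mem_redF] at h
    simp at h ⊢; omega
  · rintro ⟨x, y, z⟩ h
    simp

lemma card_badC (n : ℕ) : (badC n).card = (tri (n + 1)).card := by
  refine Finset.card_bij' (fun p _ => ⟨p.2, p.1.1.1 + p.1.2 - 1, p.1.1.1 - 1⟩)
    (fun q _ => (((q.2.2 + 1, q.1), q.2.1 - q.2.2), q.1)) ?_ ?_ ?_ ?_
  · rintro ⟨⟨⟨a, b⟩, c⟩, d⟩ h
    rw [badC, Finset.mem_filter, mem_redF] at h
    simp at h; simp [tri]; omega
  · rintro ⟨x, y, z⟩ h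
    simp [tri] at h
    rw [badC, Finset.mem_filter, mem_redF]
    simp; omega
  · rintro ⟨⟨⟨a, b⟩, c⟩, d⟩ h
    rw [badC, Finset.mem_filter, mem_redF] at h
    simp at h ⊢; omega
  · rintro ⟨x, y, z⟩ h
    simp [tri] at h
    simp; omega

lemma mem_canF2 (n a b c d : ℕ) : (((a, b), c), d) ∈ canF n ↔
    (((a, b), c), d) ∈ redF n ∧ ¬ Bad a b c d := by
  rw [canF, Finset.mem_filter]

lemma card_total (n : ℕ) :
    (canF n).card + ((badA n).card + (badB n).card + (badC n).card) = (redF n).card := by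
  rw [← Finset.card_union_of_disjoint, ← Finset.card_union_of_disjoint,
    ← Finset.card_union_of_disjoint]
  · congr 1
    ext ⟨⟨⟨a, b⟩, c⟩, d⟩
    simp only [mem_canF2, badA, badB, badC, Finset.mem_union, Finset.mem_filter]
    unfold Bad
    by_cases hr : (((a, b), c), d) ∈ redF n
    · simp only [hr, true_and, iff_true]; omega
    · simp only [hr, false_and, or_false]
  · rw [Finset.disjoint_left]
    rintro ⟨⟨⟨a, b⟩, c⟩, d⟩
    simp only [mem_canF2, badA, badB, badC, Finset.mem_union, Finset.mem_filter]
    unfold Bad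
    by_cases hr : (((a, b), c), d) ∈ redF n
    · simp only [hr, true_and]; omega
    · simp only [hr, false_and, false_imp_iff]
  · rw [Finset.disjoint_left]
    rintro ⟨⟨⟨a, b⟩, c⟩, d⟩
    simp only [badA, badB, badC, Finset.mem_union, Finset.mem_filter, mem_redF]
    simp; omega
  · rw [Finset.disjoint_left]
    rintro ⟨⟨⟨a, b⟩, c⟩, d⟩
    simp only [badA, badB, Finset.mem_filter, mem_redF]
    simp; omega

/-- For `n ≥ 1`, the number of signed permutations in `B_n` at burnt-pancake distance
exactly `4` from the identity is `n(n-1)²(2n-3)/2`. -/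
theorem burnt_count_distance_four (n : ℕ) (hn : 1 ≤ n) :
    2 * (Nat.card {π : Equiv.Perm ℤ // burntDistEq n 4 π} : ℤ)
      = (n : ℤ) * ((n : ℤ) - 1) ^ 2 * (2 * (n : ℤ) - 3) := by 
  rw [card_dist]
  have h := card_total n
  rw [card_badA, card_badB, card_badC, card_redF] at h
  have h1 := six_tri n
  have h2 := six_tri (n + 1)
  zify [hn] at h
  push_cast at h2
  have h3 : (3 : ℤ) * (2 * ((canF n).card : ℤ))
      = 3 * ((n : ℤ) * ((n : ℤ) - 1) ^ 2 * (2 * (n : ℤ) - 3)) := by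
    linear_combination 6 * h - 2 * h1 - h2
  exact mul_left_cancel₀ (by norm_num) h3
end
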